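/- arXiv:2307.00687 — 6 statements merged into one kernel-verified Lean document; each statement's English description precedes it below -/
import Mathlib

section
/- Let X_1, …, X_{d+1} be i.i.d. d-dimensional random vectors with finite second moment. Then det cov(X_1) = (d!/(d+1)) · E(vol[X_1, …, X_{d+1}]²), where cov(X_1) is the covariance matrix of X_1 and vol[X_1,…,X_{d+1}] is the d-dimensional volume of the convex hull of X_1, …, X_{d+1}. -/
open MeasureTheory

/-- The volume of the corner simplex `{t | 0 ≤ t, ∑ t ≤ r}` in `ℝ^d` is `r ^ d / d!`. -/
theorem volume_cornerSimplex (d : ℕ) (r : ℝ) (hr : 0 ≤ r) :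
    volume {t : Fin d → ℝ | (∀ i, 0 ≤ t i) ∧ ∑ i, t i ≤ r} =
      ENNReal.ofReal (r ^ d / d.factorial) := by
  induction d generalizing r with
  | zero => simp [hr, volume_pi]
  | succ d ih =>
    have hmeas : MeasurableSet {p : ℝ × (Fin d → ℝ) |
        0 ≤ p.1 ∧ (∀ i, 0 ≤ p.2 i) ∧ p.1 + ∑ i, p.2 i ≤ r} := by
      measurability
    have hpre : {t : Fin (d + 1) → ℝ | (∀ i, 0 ≤ t i) ∧ ∑ i, t i ≤ r} =
        MeasurableEquiv.piFinSuccAbove (fun _ => ℝ) 0 ⁻¹' {p : ℝ × (Fin d → ℝ) |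
          0 ≤ p.1 ∧ (∀ i, 0 ≤ p.2 i) ∧ p.1 + ∑ i, p.2 i ≤ r} := by
      ext t
      simp [Fin.forall_fin_succ, Fin.sum_univ_succ, Fin.tail, and_assoc]
    rw [hpre, (volume_preserving_piFinSuccAbove (fun _ => ℝ) 0).measure_preimage
      hmeas.nullMeasurableSet, Measure.volume_eq_prod, Measure.prod_apply hmeas]
    have hslice (a : ℝ) : volume (Prod.mk a ⁻¹' {p : ℝ × (Fin d → ℝ) |
        0 ≤ p.1 ∧ (∀ i, 0 ≤ p.2 i) ∧ p.1 + ∑ i, p.2 i ≤ r}) =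
        (Set.Icc 0 r).indicator
          (fun a => ENNReal.ofReal ((r - a) ^ d / d.factorial)) a := by
      by_cases ha : a ∈ Set.Icc 0 r
      · rw [Set.indicator_of_mem ha, ← ih (r - a) (sub_nonneg.2 ha.2)]
        congr 1
        ext t
        simp [ha.1, le_sub_iff_add_le']
      · rw [Set.indicator_of_notMem ha]
        convert measure_empty (μ := (volume : Measure (Fin d → ℝ)))
        ext t
        simp only [Set.mem_preimage, Set.mem_ofPred_eq, Set.mem_empty_iff_false, iff_false]
        rintro ⟨h0, h1, h2⟩
        exact ha ⟨h0, by linarith [Finset.sum_nonneg fun i (_ : i ∈ Finset.univ) => h1 i]⟩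
    simp_rw [hslice]
    rw [lintegral_indicator measurableSet_Icc, ← ofReal_integral_eq_lintegral_ofReal]
    · congr 1
      rw [integral_Icc_eq_integral_Ioc, ← intervalIntegral.integral_of_le hr,
        intervalIntegral.integral_comp_sub_left (fun a => a ^ d / (d.factorial : ℝ))]
      simp [Nat.factorial_succ]
      field_simp
    · exact (by fun_prop : Continuous fun a : ℝ =>
        (r - a) ^ d / (d.factorial : ℝ)).integrableOn_Icc
    · filter_upwards [ae_restrict_mem measurableSet_Icc] with a ha
      have := sub_nonneg.2 ha.2
      simp only [Pi.zero_apply]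
      positivity

/-- The volume of a simplex with vertices `x` is `|det (x_{i+1} - x_0)| / d!`. -/
theorem volume_convexHull_range (d : ℕ) (x : Fin (d + 1) → Fin d → ℝ) :
    (volume (convexHull ℝ (Set.range x))).toReal =
      |(Matrix.of fun i j : Fin d => x i.succ j - x 0 j).det| / d.factorial := by
  set B : Matrix (Fin d) (Fin d) ℝ := Matrix.of fun i j => x i.succ j - x 0 j
  have hset : convexHull ℝ (Set.range x) = (fun y => x 0 + y) ''
      (Matrix.toLin' B.transpose '' {t : Fin d → ℝ | (∀ i, 0 ≤ t i) ∧ ∑ i, t i ≤ 1}) := by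
    have hx : convexHull ℝ (Set.range x) =
        Fintype.linearCombination ℝ x '' stdSimplex ℝ (Fin (d + 1)) := by
      rw [← convexHull_rangle_single_eq_stdSimplex, LinearMap.image_convexHull,
        ← Set.range_comp]
      congr 2
      ext i
      simp
    have hB (w : Fin (d + 1) → ℝ) (hw : ∑ i, w i = 1) :
        Fintype.linearCombination ℝ x w =
          x 0 + Matrix.toLin' B.transpose (fun i => w i.succ) := by
      ext j
      rw [Fin.sum_univ_succ] at hw
      simp only [Fintype.linearCombination_apply, Fin.sum_univ_succ, Finset.sum_apply,
        Pi.add_apply, Pi.smul_apply, smul_eq_mul, Matrix.toLin'_apply, Matrix.mulVec,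
        dotProduct, Matrix.transpose_apply, B, Matrix.of_apply, sub_mul, Finset.sum_sub_distrib,
        ← Finset.mul_sum]
      rw [Finset.sum_congr rfl fun i _ => mul_comm (w (Fin.succ i)) (x i.succ j)]
      linear_combination x 0 j * hw
    rw [hx]
    ext y
    constructor
    · rintro ⟨w, ⟨hw0, hw1⟩, rfl⟩
      refine ⟨_, ⟨fun i => w i.succ, ⟨fun i => hw0 _, ?_⟩, rfl⟩, (hB w hw1).symm⟩
      rw [Fin.sum_univ_succ] at hw1
      linarith [hw0 0]
    · rintro ⟨_, ⟨t, ⟨ht0, ht1⟩, rfl⟩, rfl⟩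
      have hsum : ∑ i, (Fin.cons (1 - ∑ i, t i) t : Fin (d + 1) → ℝ) i = 1 := by
        simp [Fin.sum_univ_succ]
      refine ⟨Fin.cons (1 - ∑ i, t i) t, ⟨?_, hsum⟩, by simpa using hB _ hsum⟩
      refine Fin.cases ?_ ?_ <;> simp [ht0, ht1]
  rw [hset, Set.image_add_left, measure_preimage_add, Measure.addHaar_image_linearMap,
    volume_cornerSimplex d 1 zero_le_one, LinearMap.det_toLin', Matrix.det_transpose,
    ENNReal.toReal_mul, ENNReal.toReal_ofReal (abs_nonneg _), ENNReal.toReal_ofReal (by positivity)]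
  simp [div_eq_mul_inv]

/-- Andréief's identity for the second moment of a random determinant. -/
theorem integral_det_sq {E ι : Type*} [MeasurableSpace E] [Fintype ι] [DecidableEq ι]
    (μ : Measure E) [SigmaFinite μ] (f : ι → E → ℝ)
    (hf : ∀ j k, Integrable (fun x => f j x * f k x) μ) :
    ∫ x : ι → E, (Matrix.of fun i j => f j (x i)).det ^ 2 ∂(Measure.pi fun _ => μ) =
      (Fintype.card ι).factorial * (Matrix.of fun j k => ∫ x, f j x * f k x ∂μ).det := by
  have hexp (x : ι → E) : (Matrix.of fun i j => f j (x i)).det ^ 2 =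
      ∑ σ : Equiv.Perm ι, ∑ τ : Equiv.Perm ι,
        ((Equiv.Perm.sign σ : ℤ) : ℝ) * ((Equiv.Perm.sign τ : ℤ) : ℝ) *
          ∏ i, f (σ i) (x i) * f (τ i) (x i) := by
    rw [← Matrix.det_transpose, Matrix.det_apply', sq, Finset.sum_mul_sum]
    refine Finset.sum_congr rfl fun σ _ => Finset.sum_congr rfl fun τ _ => ?_
    simp only [Matrix.transpose_apply, Matrix.of_apply, Finset.prod_mul_distrib]
    ring
  have hint (σ τ : Equiv.Perm ι) : Integrable (fun x : ι → E =>
      ((Equiv.Perm.sign σ : ℤ) : ℝ) * ((Equiv.Perm.sign τ : ℤ) : ℝ) *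
        ∏ i, f (σ i) (x i) * f (τ i) (x i)) (Measure.pi fun _ => μ) :=
    (Integrable.fintype_prod (f := fun i y => f (σ i) y * f (τ i) y)
      fun i => hf _ _).const_mul _
  simp_rw [hexp]
  rw [integral_finsetSum _ fun σ _ => integrable_finsetSum _ fun τ _ => hint σ τ]
  have hrow (σ : Equiv.Perm ι) : ∫ x : ι → E, ∑ τ : Equiv.Perm ι,
      ((Equiv.Perm.sign σ : ℤ) : ℝ) * ((Equiv.Perm.sign τ : ℤ) : ℝ) *
        ∏ i, f (σ i) (x i) * f (τ i) (x i) ∂(Measure.pi fun _ => μ) =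
      (Matrix.of fun j k => ∫ x, f j x * f k x ∂μ).det := by
    rw [integral_finsetSum _ fun τ _ => hint σ τ]
    have hperm := Matrix.det_permute σ (Matrix.of fun j k => ∫ x, f j x * f k x ∂μ)
    have hsign : ((Equiv.Perm.sign σ : ℤ) : ℝ) * ((Equiv.Perm.sign σ : ℤ) : ℝ) = 1 := by
      norm_cast
      simp
    rw [← one_mul (Matrix.det _), ← hsign, mul_assoc, ← hperm, ← Matrix.det_transpose,
      Matrix.det_apply', Finset.mul_sum]
    refine Finset.sum_congr rfl fun τ _ => ?_
    rw [integral_const_mul,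
      integral_fintype_prod_eq_prod (fun i y => f (σ i) y * f (τ i) y), mul_assoc]
    rfl
  simp [hrow, Fintype.card_perm]

/-- Bordering the rows `x_i - m` by ones gives the determinant of the edge vectors. -/
theorem det_bordered_eq_det_sub {d : ℕ} (x : Fin (d + 1) → Fin d → ℝ) (m : Fin d → ℝ) :
    (Matrix.of fun i j : Fin (d + 1) =>
        (Fin.cons 1 (fun k => x i k - m k) : Fin (d + 1) → ℝ) j).det =
      (Matrix.of fun i j : Fin d => x i.succ j - x 0 j).det := by
  let c : Fin (d + 1) → ℝ := Fin.cons 0 fun _ => 1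
  rw [Matrix.det_eq_of_forall_row_eq_smul_add_const
    (B := Matrix.of fun i j : Fin (d + 1) => Fin.cases
      ((Fin.cons 1 (fun k => x 0 k - m k) : Fin (d + 1) → ℝ) j)
      (fun i => (Fin.cons 0 (fun k => x i.succ k - x 0 k) : Fin (d + 1) → ℝ) j) i)
    c 0 rfl]
  · rw [Matrix.det_succ_column_zero, Fin.sum_univ_succ]
    simp [Matrix.submatrix]
  · refine Fin.cases ?_ fun i => ?_ <;> refine Fin.cases ?_ fun j => ?_ <;> simp [c]

/-- Blaschke's formula: for i.i.d. random vectors `X₁, …, X_{d+1}` in `ℝ^d` with law `μ`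
having finite second moments, the determinant of the covariance matrix of `X₁` equals
`(d!/(d+1))` times the expected squared volume of the simplex `[X₁, …, X_{d+1}]`. -/
theorem stmt7 (d : ℕ) (hd : 0 < d) (μ : Measure (Fin d → ℝ)) [IsProbabilityMeasure μ]
    (h2 : ∀ i, Integrable (fun x => x i ^ 2) μ) :
    Matrix.det (Matrix.of fun i j : Fin d =>
        ∫ x, (x i - ∫ y, y i ∂μ) * (x j - ∫ y, y j ∂μ) ∂μ) =
      ((d.factorial : ℝ) / ((d : ℝ) + 1)) *
        ∫ x : Fin (d + 1) → Fin d → ℝ,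
          ((volume (convexHull ℝ (Set.range x))).toReal) ^ 2
          ∂(Measure.pi fun _ : Fin (d + 1) => μ) := by
  let m : Fin d → ℝ := fun i => ∫ y, y i ∂μ
  let f : Fin (d + 1) → (Fin d → ℝ) → ℝ := fun j y =>
    (Fin.cons 1 (fun k => y k - m k) : Fin (d + 1) → ℝ) j
  have hLp (i : Fin d) : MemLp (fun y : Fin d → ℝ => y i) 2 μ :=
    (memLp_two_iff_integrable_sq (measurable_pi_apply i).aestronglyMeasurable).2 (h2 i)
  have hfLp : ∀ j, MemLp (f j) 2 μ :=
    Fin.cases (by simpa [f] using memLp_const (1 : ℝ))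
      fun i => (hLp i).sub (memLp_const (m i))
  have hmean (i : Fin d) : ∫ y, (y i - m i) ∂μ = 0 := by
    rw [integral_sub ((hLp i).integrable one_le_two) (integrable_const _)]
    simp [m]
  have hgram : (Matrix.of fun j k => ∫ y, f j y * f k y ∂μ).det =
      Matrix.det (Matrix.of fun i j : Fin d =>
        ∫ x, (x i - ∫ y, y i ∂μ) * (x j - ∫ y, y j ∂μ) ∂μ) := by
    rw [Matrix.det_succ_column_zero, Fin.sum_univ_succ]
    simp [f, hmean, Matrix.submatrix, m]
  have hvol (x : Fin (d + 1) → Fin d → ℝ) :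
      ((volume (convexHull ℝ (Set.range x))).toReal) ^ 2 =
        (Matrix.of fun i j => f j (x i)).det ^ 2 / (d.factorial : ℝ) ^ 2 := by
    rw [volume_convexHull_range, div_pow, sq_abs, ← det_bordered_eq_det_sub x m]
  simp_rw [hvol]
  rw [integral_div, integral_det_sq μ f fun j k => (hfLp j).integrable_mul (hfLp k), hgram,
    Fintype.card_fin, Nat.factorial_succ]
  push_cast
  have : (d.factorial : ℝ) ≠ 0 := by positivity
  field_simp
end

section
/- If X is a real-valued, mean-zero, log-concave random variable, then E(|X|) ≥ (1/8) √(E(X²)). -/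
open MeasureTheory

/-- `f` is a log-concave (nonnegative) function on `ℝ`. -/
def IsLogConcaveFun (f : ℝ → ℝ) : Prop :=
  (∀ x, 0 ≤ f x) ∧ ∀ x y t : ℝ, 0 ≤ t → t ≤ 1 →
    f x ^ t * f y ^ (1 - t) ≤ f (t * x + (1 - t) * y)

namespace IsLogConcaveFun

open Set

variable {f : ℝ → ℝ}

theorem ordConnected_le (hf : IsLogConcaveFun f) (c : ℝ) : OrdConnected {x | c ≤ f x} := by
  rcases le_total c 0 with hc | hc
  · have : {x | c ≤ f x} = univ := eq_univ_of_forall fun x => hc.trans (hf.1 x)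
    rw [this]
    exact ordConnected_univ
  refine Convex.ordConnected fun x hx y hy s t hs ht hst => ?_
  obtain rfl : t = 1 - s := by linarith
  have hs1 : s ≤ 1 := by linarith
  calc c = c ^ s * c ^ (1 - s) := by
        rw [← Real.rpow_add_of_nonneg hc hs ht, add_sub_cancel, Real.rpow_one]
    _ ≤ f x ^ s * f y ^ (1 - s) :=
        mul_le_mul (Real.rpow_le_rpow hc hx hs) (Real.rpow_le_rpow hc hy ht)
          (Real.rpow_nonneg hc _) (Real.rpow_nonneg (hf.1 x) _)
    _ ≤ f (s * x + (1 - s) * y) := hf.2 x y s hs hs1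

theorem measurable (hf : IsLogConcaveFun f) : Measurable f :=
  measurable_of_Ici fun c => (hf.ordConnected_le c).measurableSet

theorem comp_const_add (hf : IsLogConcaveFun f) (m : ℝ) :
    IsLogConcaveFun fun x => f (m + x) := by
  refine ⟨fun x => hf.1 _, fun x y t h0 h1 => (hf.2 (m + x) (m + y) t h0 h1).trans_eq ?_⟩
  congr 1
  ring

theorem comp_neg (hf : IsLogConcaveFun f) : IsLogConcaveFun fun x => f (-x) := by
  refine ⟨fun x => hf.1 _, fun x y t h0 h1 => (hf.2 (-x) (-y) t h0 h1).trans_eq ?_⟩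
  congr 1
  ring

theorem mul_exp (hf : IsLogConcaveFun f) (b : ℝ) :
    IsLogConcaveFun fun x => f x * Real.exp (b * x) := by
  refine ⟨fun x => mul_nonneg (hf.1 x) (Real.exp_nonneg _), fun x y t h0 h1 => ?_⟩
  have hexp : Real.exp (b * x) ^ t * Real.exp (b * y) ^ (1 - t) =
      Real.exp (b * (t * x + (1 - t) * y)) := by
    rw [← Real.exp_mul, ← Real.exp_mul, ← Real.exp_add]
    congr 1
    ring
  calc (f x * Real.exp (b * x)) ^ t * (f y * Real.exp (b * y)) ^ (1 - t)
      = (f x ^ t * f y ^ (1 - t)) *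
          (Real.exp (b * x) ^ t * Real.exp (b * y) ^ (1 - t)) := by
        rw [Real.mul_rpow (hf.1 x) (Real.exp_nonneg _),
          Real.mul_rpow (hf.1 y) (Real.exp_nonneg _)]
        ring
    _ ≤ f (t * x + (1 - t) * y) * Real.exp (b * (t * x + (1 - t) * y)) := by
        rw [hexp]
        exact mul_le_mul_of_nonneg_right (hf.2 x y t h0 h1) (Real.exp_nonneg _)

end IsLogConcaveFun

theorem integral_pow_mul_exp_neg_mul_Ioi {b : ℝ} (hb : 0 < b) (n : ℕ) :
    ∫ x in Set.Ioi (0 : ℝ), x ^ n * Real.exp (-(b * x)) = n.factorial / b ^ (n + 1) := by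
  have h := Real.integral_rpow_mul_exp_neg_mul_Ioi (a := (n : ℝ) + 1) (by positivity) hb
  rw [Real.Gamma_nat_eq_factorial, add_sub_cancel_right] at h
  simp_rw [Real.rpow_natCast] at h
  rw [h]
  have : ((n : ℝ) + 1) = ((n + 1 : ℕ) : ℝ) := by push_cast; ring
  rw [this, Real.rpow_natCast, one_div, inv_pow]
  field_simp

theorem integrableOn_pow_mul_exp_neg_mul_Ioi {b : ℝ} (hb : 0 < b) (n : ℕ) :
    IntegrableOn (fun x : ℝ => x ^ n * Real.exp (-(b * x))) (Set.Ioi 0) := by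
  by_contra h
  have h0 := integral_undef h
  rw [integral_pow_mul_exp_neg_mul_Ioi hb] at h0
  have : 0 < (n.factorial : ℝ) / b ^ (n + 1) := by positivity
  exact this.ne' h0

/-- If `u` is nonnegative on an order-connected set, nonpositive elsewhere on `(0, ∞)`, and has
vanishing moments of order `0` and `1`, then its second moment is nonpositive. -/
theorem integral_sq_mul_nonpos_of_ordConnected {u : ℝ → ℝ} {S : Set ℝ} (hS : S.OrdConnected)
    (hS0 : S ⊆ Set.Ioi 0) (hpos : ∀ x ∈ S, 0 ≤ u x) (hneg : ∀ x, 0 < x → x ∉ S → u x ≤ 0)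
    (hi0 : IntegrableOn u (Set.Ioi 0)) (hi1 : IntegrableOn (fun x => x * u x) (Set.Ioi 0))
    (hi2 : IntegrableOn (fun x => x ^ 2 * u x) (Set.Ioi 0))
    (h0 : ∫ x in Set.Ioi 0, u x = 0) (h1 : ∫ x in Set.Ioi 0, x * u x = 0) :
    ∫ x in Set.Ioi 0, x ^ 2 * u x ≤ 0 := by
  have hbelow : BddBelow S := ⟨0, fun x hx => (hS0 hx).le⟩
  by_cases hbdd : BddAbove S
  · set α := sInf S
    set β := sSup S
    have hpt : ∀ x ∈ Set.Ioi (0 : ℝ), (x - α) * (x - β) * u x ≤ 0 := by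
      intro x hx
      by_cases hxS : x ∈ S
      · exact mul_nonpos_of_nonpos_of_nonneg
          (mul_nonpos_of_nonneg_of_nonpos (sub_nonneg.2 (csInf_le hbelow hxS))
            (sub_nonpos.2 (le_csSup hbdd hxS))) (hpos x hxS)
      · refine mul_nonpos_of_nonneg_of_nonpos ?_ (hneg x hx hxS)
        rcases S.eq_empty_or_nonempty with hE | hne
        · simp only [α, β, hE, Real.sInf_empty, Real.sSup_empty]
          exact mul_self_nonneg _
        · rcases le_or_gt x α with hα | hα
          · exact mul_nonneg_of_nonpos_of_nonpos (sub_nonpos.2 hα)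
              (sub_nonpos.2 (hα.trans (csInf_le_csSup hne hbelow hbdd)))
          · rcases le_or_gt β x with hβ | hβ
            · exact mul_nonneg (sub_nonneg.2 hα.le) (sub_nonneg.2 hβ)
            · obtain ⟨s, hs, hsx⟩ := exists_lt_of_csInf_lt hne hα
              obtain ⟨s', hs', hxs'⟩ := exists_lt_of_lt_csSup hne hβ
              exact (hxS (hS.out hs hs' ⟨hsx.le, hxs'.le⟩)).elim
    have hle := setIntegral_nonpos (μ := volume) measurableSet_Ioi hpt
    have hi21 : IntegrableOn (fun x => x ^ 2 * u x - (α + β) * (x * u x)) (Set.Ioi 0) :=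
      hi2.sub (hi1.const_mul _)
    have heq : ∫ x in Set.Ioi 0, (x - α) * (x - β) * u x = ∫ x in Set.Ioi 0, x ^ 2 * u x := by
      calc ∫ x in Set.Ioi 0, (x - α) * (x - β) * u x
          = ∫ x in Set.Ioi 0, (x ^ 2 * u x - (α + β) * (x * u x) + α * β * u x) := by
            congr 1; ext x; ring
        _ = _ := by
            rw [integral_add hi21 (hi0.const_mul _),
              integral_sub hi2 (hi1.const_mul _), integral_const_mul, integral_const_mul, h0, h1]
            ring
    rwa [heq] at hle
  · have hne : S.Nonempty := by
      rw [Set.nonempty_iff_ne_empty]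
      rintro rfl
      exact hbdd bddAbove_empty
    set α := sInf S
    have hpt : ∀ x ∈ Set.Ioi (0 : ℝ), 0 ≤ (x - α) * u x := by
      intro x hx
      by_cases hxS : x ∈ S
      · exact mul_nonneg (sub_nonneg.2 (csInf_le hbelow hxS)) (hpos x hxS)
      · refine mul_nonneg_of_nonpos_of_nonpos ?_ (hneg x hx hxS)
        by_contra! hα
        obtain ⟨s, hs, hsx⟩ := exists_lt_of_csInf_lt hne (sub_pos.1 hα)
        obtain ⟨s', hs', hxs'⟩ := not_bddAbove_iff.1 hbdd x
        exact hxS (hS.out hs hs' ⟨hsx.le, hxs'.le⟩)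
    have hsplit : (fun x => (x - α) * u x) = fun x => x * u x - α * u x := by
      ext x; ring
    have hint : IntegrableOn (fun x => (x - α) * u x) (Set.Ioi 0) := by
      rw [hsplit]
      exact hi1.sub (hi0.const_mul _)
    have hzero : ∫ x in Set.Ioi 0, (x - α) * u x = 0 := by
      rw [hsplit, integral_sub hi1 (hi0.const_mul _), integral_const_mul, h0, h1]
      ring
    rw [setIntegral_eq_zero_iff_of_nonneg_ae
      ((ae_restrict_iff' measurableSet_Ioi).2 (Filter.Eventually.of_forall hpt)) hint] at hzero
    refine (integral_eq_zero_of_ae ?_).le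
    filter_upwards [hzero, Measure.ae_ne (volume.restrict (Set.Ioi (0 : ℝ))) α] with x hx hxα
    have : u x = 0 := by
      simpa [sub_ne_zero.2 hxα] using hx
    simp [this]

/-- Berwald's inequality for the first three moments of a log-concave function on `(0, ∞)`. -/
theorem IsLogConcaveFun.integral_mul_integral_sq_le {g : ℝ → ℝ} (hg : IsLogConcaveFun g)
    (hi0 : IntegrableOn g (Set.Ioi 0)) (hi1 : IntegrableOn (fun x => x * g x) (Set.Ioi 0))
    (hi2 : IntegrableOn (fun x => x ^ 2 * g x) (Set.Ioi 0)) :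
    (∫ x in Set.Ioi 0, g x) * ∫ x in Set.Ioi 0, x ^ 2 * g x ≤
      2 * (∫ x in Set.Ioi 0, x * g x) ^ 2 := by
  set m₀ := ∫ x in Set.Ioi 0, g x with hm₀
  set m₁ := ∫ x in Set.Ioi 0, x * g x with hm₁
  have hm₀_nonneg : 0 ≤ m₀ := setIntegral_nonneg measurableSet_Ioi fun x _ => hg.1 x
  have hpt : ∀ x ∈ Set.Ioi (0 : ℝ), 0 ≤ x * g x := fun x hx => mul_nonneg (le_of_lt hx) (hg.1 x)
  have hm₁_nonneg : 0 ≤ m₁ := setIntegral_nonneg measurableSet_Ioi hpt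
  rcases hm₀_nonneg.eq_or_lt with h | hm₀_pos
  · rw [← h, zero_mul]
    positivity
  have hm₁_pos : 0 < m₁ := by
    refine lt_of_le_of_ne hm₁_nonneg fun h => hm₀_pos.ne' ?_
    have hzero := h.symm
    rw [hm₁, setIntegral_eq_zero_iff_of_nonneg_ae
      ((ae_restrict_iff' measurableSet_Ioi).2 (Filter.Eventually.of_forall hpt)) hi1] at hzero
    refine integral_eq_zero_of_ae ?_
    filter_upwards [hzero, Measure.ae_ne (volume.restrict (Set.Ioi (0 : ℝ))) 0] with x hx hx0
    simpa [hx0] using hx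
  obtain ⟨b, hb_pos, hb⟩ : ∃ b, 0 < b ∧ m₀ = b * m₁ :=
    ⟨m₀ / m₁, div_pos hm₀_pos hm₁_pos, (div_mul_cancel₀ _ hm₁_pos.ne').symm⟩
  obtain ⟨A, hA⟩ : ∃ A, A = b ^ 2 * m₁ := ⟨_, rfl⟩
  have hE := integrableOn_pow_mul_exp_neg_mul_Ioi hb_pos
  have hE' := integral_pow_mul_exp_neg_mul_Ioi hb_pos
  have hcomb (n : ℕ) (h : IntegrableOn (fun x => x ^ n * g x) (Set.Ioi 0)) :
      IntegrableOn (fun x => x ^ n * (g x - A * Real.exp (-(b * x)))) (Set.Ioi 0) ∧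
      ∫ x in Set.Ioi 0, x ^ n * (g x - A * Real.exp (-(b * x))) =
        (∫ x in Set.Ioi 0, x ^ n * g x) - A * (n.factorial / b ^ (n + 1)) := by
    have hfun : (fun x => x ^ n * (g x - A * Real.exp (-(b * x)))) =
        fun x => x ^ n * g x - A * (x ^ n * Real.exp (-(b * x))) := by
      ext x; ring
    rw [hfun]
    refine ⟨h.sub ((hE n).const_mul A), ?_⟩
    rw [integral_sub h ((hE n).const_mul A), integral_const_mul, hE']
  obtain ⟨hu0, hu0'⟩ := hcomb 0 (by simpa using hi0)
  obtain ⟨hu1, hu1'⟩ := hcomb 1 (by simpa using hi1)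
  obtain ⟨hu2, hu2'⟩ := hcomb 2 hi2
  simp only [pow_zero, one_mul, pow_one, Nat.factorial, ← hm₀, ← hm₁] at hu0 hu0' hu1 hu1'
  have hsign (x : ℝ) : A ≤ g x * Real.exp (b * x) ↔ 0 ≤ g x - A * Real.exp (-(b * x)) := by
    rw [sub_nonneg, Real.exp_neg, ← div_eq_mul_inv, div_le_iff₀ (Real.exp_pos _)]
  have key := integral_sq_mul_nonpos_of_ordConnected
    (S := Set.Ioi 0 ∩ {x | A ≤ g x * Real.exp (b * x)})
    (Set.ordConnected_Ioi.inter ((hg.mul_exp b).ordConnected_le A)) Set.inter_subset_left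
    (fun x hx => (hsign x).1 hx.2)
    (fun x hx hxS => (not_le.1 fun h => hxS ⟨hx, (hsign x).2 h⟩).le) hu0 hu1 hu2
    (by rw [hu0', hA, hb]; field_simp; simp) (by rw [hu1', hA]; field_simp; simp)
  rw [hu2', sub_nonpos] at key
  calc m₀ * ∫ x in Set.Ioi 0, x ^ 2 * g x
      ≤ m₀ * (A * ((2 : ℕ).factorial / b ^ (2 + 1))) :=
        mul_le_mul_of_nonneg_left key hm₀_nonneg
    _ = 2 * m₁ ^ 2 := by
        rw [hA, hb, Nat.factorial_two]
        field_simp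
        norm_num

theorem integral_eq_setIntegral_Ioi_add_comp_neg {φ : ℝ → ℝ} (h : Integrable φ) :
    ∫ x, φ x = (∫ x in Set.Ioi 0, φ (-x)) + ∫ x in Set.Ioi 0, φ x := by
  have hneg := integral_comp_neg_Iic 0 fun x => φ (-x)
  simp only [neg_neg, neg_zero] at hneg
  rw [← intervalIntegral.integral_Iic_add_Ioi (b := 0) h.integrableOn h.integrableOn, hneg]

/-- A log-concave density with median `0` satisfies `E X² ≤ 4 (E |X|)²`. -/
theorem IsLogConcaveFun.integral_sq_mul_le_of_median {F : ℝ → ℝ} (hF : IsLogConcaveFun F)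
    (hi0 : Integrable F) (hi1 : Integrable fun x => x * F x)
    (hi2 : Integrable fun x => x ^ 2 * F x)
    (hneg : ∫ x in Set.Ioi 0, F (-x) = 1 / 2) (hpos : ∫ x in Set.Ioi 0, F x = 1 / 2) :
    ∫ x, x ^ 2 * F x ≤ 4 * (∫ x, |x| * F x) ^ 2 := by
  have hiabs : Integrable fun x => |x| * F x := by
    refine hi1.abs.congr (Filter.Eventually.of_forall fun x => ?_)
    simp only [abs_mul, abs_of_nonneg (hF.1 x)]
  have hr := hF.integral_mul_integral_sq_le hi0.integrableOn hi1.integrableOn hi2.integrableOn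
  have hl := hF.comp_neg.integral_mul_integral_sq_le hi0.comp_neg.integrableOn
    (by simpa using hi1.comp_neg.neg.integrableOn) (by simpa using hi2.comp_neg.integrableOn)
  have hsq := integral_eq_setIntegral_Ioi_add_comp_neg hi2
  have habs := integral_eq_setIntegral_Ioi_add_comp_neg hiabs
  have habs_pos : ∫ x in Set.Ioi 0, |x| * F x = ∫ x in Set.Ioi 0, x * F x :=
    setIntegral_congr_fun measurableSet_Ioi fun x hx => by
      simp only [abs_of_pos (Set.mem_Ioi.1 hx)]
  have habs_neg : ∫ x in Set.Ioi 0, |-x| * F (-x) = ∫ x in Set.Ioi 0, x * F (-x) :=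
    setIntegral_congr_fun measurableSet_Ioi fun x hx => by
      simp only [abs_neg, abs_of_pos (Set.mem_Ioi.1 hx)]
  simp only [neg_sq] at hsq
  rw [habs_pos, habs_neg] at habs
  rw [hsq, habs]
  rw [hneg] at hl
  rw [hpos] at hr
  have hl0 : 0 ≤ ∫ x in Set.Ioi 0, x * F (-x) :=
    setIntegral_nonneg measurableSet_Ioi fun x hx => mul_nonneg (le_of_lt hx) (hF.1 _)
  have hr0 : 0 ≤ ∫ x in Set.Ioi 0, x * F x :=
    setIntegral_nonneg measurableSet_Ioi fun x hx => mul_nonneg (le_of_lt hx) (hF.1 _)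
  nlinarith [mul_nonneg hl0 hr0]

theorem exists_integral_Iic_eq_integral_Ioi {f : ℝ → ℝ} (hf : Integrable f)
    (hpos : 0 < ∫ x, f x) :
    ∃ m, ∫ x in Set.Iic m, f x = ∫ x in Set.Ioi m, f x := by
  have hsum (m : ℝ) := intervalIntegral.integral_Iic_add_Ioi (b := m) (μ := volume)
    hf.integrableOn hf.integrableOn
  have hprim (m : ℝ) := intervalIntegral.integral_Iic_sub_Iic (a := 0) (b := m) (μ := volume)
    hf.integrableOn hf.integrableOn
  set c := (∫ x, f x) / 2 - ∫ x in Set.Iic 0, f x with hc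
  have htop := intervalIntegral_tendsto_integral_Ioi 0 (hf.integrableOn (s := Set.Ioi 0))
    Filter.tendsto_id
  have hbot := intervalIntegral_tendsto_integral_Iic 0 (hf.integrableOn (s := Set.Iic 0))
    Filter.tendsto_id
  have h0 := hsum 0
  obtain ⟨a, ha⟩ := (hbot.eventually (lt_mem_nhds (a := -c) (by linarith))).exists
  obtain ⟨b, hb⟩ := (htop.eventually (lt_mem_nhds (a := c) (by linarith))).exists
  obtain ⟨m, hm⟩ := mem_range_of_exists_le_of_exists_ge (c := c)
    (intervalIntegral.continuous_primitive (fun a b => hf.intervalIntegrable) 0)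
    ⟨a, by rw [intervalIntegral.integral_symm]; simp only [id] at ha; linarith⟩ ⟨b, hb.le⟩
  refine ⟨m, ?_⟩
  have h1 := hsum m
  have h2 := hprim m
  simp only at hm
  linarith

/-- The median minimizes the mean absolute deviation. -/
theorem integral_abs_sub_mul_le_of_median {f : ℝ → ℝ} (hf : ∀ x, 0 ≤ f x) {m : ℝ}
    (hi0 : Integrable f) (hi1 : Integrable fun x => |x| * f x)
    (hm : ∫ x in Set.Iic m, f x = ∫ x in Set.Ioi m, f x) :
    ∫ x, |x - m| * f x ≤ ∫ x, |x| * f x := by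
  have hl : Integrable ((Set.Iic m).indicator f) := hi0.indicator measurableSet_Iic
  have hr : Integrable ((Set.Ioi m).indicator f) := hi0.indicator measurableSet_Ioi
  have hlr : Integrable fun x =>
      m * ((Set.Iic m).indicator f x - (Set.Ioi m).indicator f x) := (hl.sub hr).const_mul m
  calc ∫ x, |x - m| * f x
      ≤ ∫ x, (|x| * f x + m * ((Set.Iic m).indicator f x - (Set.Ioi m).indicator f x)) := by
        refine integral_mono_of_nonneg
          (Filter.Eventually.of_forall fun x => mul_nonneg (abs_nonneg _) (hf x))
          (hi1.add hlr) (Filter.Eventually.of_forall fun x => ?_)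
        rcases le_or_gt x m with h | h
        · have h' : x ∉ Set.Ioi m := not_lt.2 h
          have hin : x ∈ Set.Iic m := h
          simp only [Set.indicator_of_mem hin, Set.indicator_of_notMem h', sub_zero, ← add_mul]
          refine mul_le_mul_of_nonneg_right ?_ (hf x)
          rw [abs_of_nonpos (sub_nonpos.2 h)]
          linarith [neg_abs_le x]
        · have h' : x ∉ Set.Iic m := not_le.2 h
          have hin : x ∈ Set.Ioi m := h
          simp only [Set.indicator_of_mem hin, Set.indicator_of_notMem h', zero_sub, mul_neg,
            ← sub_eq_add_neg, ← sub_mul]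
          refine mul_le_mul_of_nonneg_right ?_ (hf x)
          rw [abs_of_pos (sub_pos.2 h)]
          linarith [le_abs_self x]
    _ = ∫ x, |x| * f x := by
        rw [integral_add hi1 hlr, integral_const_mul, integral_sub hl hr,
          integral_indicator measurableSet_Iic, integral_indicator measurableSet_Ioi, hm]
        ring

/-- A centered log-concave density satisfies `E X² ≤ 4 (E |X|)²`. -/
theorem IsLogConcaveFun.integral_sq_mul_le_of_centered {f : ℝ → ℝ} (hf : IsLogConcaveFun f)
    (hi0 : Integrable f) (hi1 : Integrable fun x => x * f x)
    (hi2 : Integrable fun x => x ^ 2 * f x) (hmass : ∫ x, f x = 1)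
    (hmean : ∫ x, x * f x = 0) :
    ∫ x, x ^ 2 * f x ≤ 4 * (∫ x, |x| * f x) ^ 2 := by
  have hiabs : Integrable fun x => |x| * f x := by
    refine hi1.abs.congr (Filter.Eventually.of_forall fun x => ?_)
    simp only [abs_mul, abs_of_nonneg (hf.1 x)]
  obtain ⟨m, hm⟩ := exists_integral_Iic_eq_integral_Ioi hi0 (by rw [hmass]; exact one_pos)
  have hsum := intervalIntegral.integral_Iic_add_Ioi (b := m) (μ := volume)
    hi0.integrableOn hi0.integrableOn
  have hj1 : Integrable fun x => (x - m) * f x := by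
    simp only [sub_mul]
    exact hi1.sub (hi0.const_mul m)
  have hexp : (fun x => (x - m) ^ 2 * f x) =
      fun x => x ^ 2 * f x - 2 * m * (x * f x) + m ^ 2 * f x := by
    ext x; ring
  have hi21 : Integrable fun x => x ^ 2 * f x - 2 * m * (x * f x) := hi2.sub (hi1.const_mul _)
  have hj2 : Integrable fun x => (x - m) ^ 2 * f x := by
    rw [hexp]
    exact hi21.add (hi0.const_mul _)
  have hvar : ∫ x, (x - m) ^ 2 * f x = (∫ x, x ^ 2 * f x) + m ^ 2 := by
    rw [hexp, integral_add hi21 (hi0.const_mul _),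
      integral_sub hi2 (hi1.const_mul _), integral_const_mul, integral_const_mul, hmass, hmean]
    ring
  have hIoi : ∫ x in Set.Ioi 0, f (m + x) = ∫ x in Set.Ioi m, f x := by
    rw [← integral_indicator measurableSet_Ioi, ← integral_indicator measurableSet_Ioi,
      ← integral_add_left_eq_self ((Set.Ioi m).indicator f) m]
    congr 1
    ext x
    simp [Set.indicator_apply]
  have hleft : (∫ x in Set.Ioi 0, f (m + -x)) + ∫ x in Set.Ioi 0, f (m + x) = 1 := by
    rw [← integral_eq_setIntegral_Ioi_add_comp_neg (hi0.comp_add_left m),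
      integral_add_left_eq_self f m, hmass]
  have key := (hf.comp_const_add m).integral_sq_mul_le_of_median (hi0.comp_add_left m)
    (by simpa using hj1.comp_add_left m) (by simpa using hj2.comp_add_left m)
    (by linarith) (by linarith)
  have hsq := integral_add_left_eq_self (μ := volume) (fun x => (x - m) ^ 2 * f x) m
  have habs := integral_add_left_eq_self (μ := volume) (fun x => |x - m| * f x) m
  simp only [add_sub_cancel_left] at hsq habs
  rw [hsq, habs, hvar] at key
  have hnn : 0 ≤ ∫ x, |x - m| * f x :=
    integral_nonneg fun x => mul_nonneg (abs_nonneg _) (hf.1 x)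
  have hdev := integral_abs_sub_mul_le_of_median hf.1 hi0 hiabs hm
  have hpow := pow_le_pow_left₀ hnn hdev 2
  linarith [sq_nonneg m]

/-- If `X` is a real-valued mean-zero random variable whose law `μ` has a log-concave
density, then `E|X| ≥ (1/8)√(E X²)`. -/
theorem stmt10 (f : ℝ → ℝ) (μ : Measure ℝ)
    (hμ : μ = volume.withDensity fun x => ENNReal.ofReal (f x))
    (hf : IsLogConcaveFun f) (hprob : IsProbabilityMeasure μ)
    (hmean : ∫ x, x ∂μ = 0) :
    (1 / 8 : ℝ) * Real.sqrt (∫ x, x ^ 2 ∂μ) ≤ ∫ x, |x| ∂μ := by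
  have habs_nonneg : 0 ≤ ∫ x, |x| ∂μ := integral_nonneg fun x => abs_nonneg x
  by_cases h2 : Integrable (fun x : ℝ => x ^ 2) μ
  swap
  · rw [integral_undef h2, Real.sqrt_zero, mul_zero]
    exact habs_nonneg
  have h1 : Integrable (fun x : ℝ => x) μ :=
    ((memLp_two_iff_integrable_sq aestronglyMeasurable_id).2 h2).integrable one_le_two
  have h0 : Integrable (fun _ : ℝ => (1 : ℝ)) μ := integrable_const 1
  have hmass : ∫ _, (1 : ℝ) ∂μ = 1 := by simp
  have hmeas : Measurable fun x => ENNReal.ofReal (f x) := hf.measurable.ennreal_ofReal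
  have hfin : ∀ᵐ x ∂(volume : Measure ℝ), ENNReal.ofReal (f x) < ⊤ :=
    Filter.Eventually.of_forall fun _ => ENNReal.ofReal_lt_top
  have hintegral (φ : ℝ → ℝ) : ∫ x, φ x ∂μ = ∫ x, φ x * f x := by
    rw [hμ, integral_withDensity_eq_integral_toReal_smul hmeas hfin]
    simp only [ENNReal.toReal_ofReal (hf.1 _), smul_eq_mul, mul_comm]
  have hintegrable (φ : ℝ → ℝ) : Integrable φ μ ↔ Integrable fun x => φ x * f x := by
    rw [hμ, integrable_withDensity_iff hmeas hfin]
    simp only [ENNReal.toReal_ofReal (hf.1 _)]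
  rw [hintegrable] at h0 h1 h2
  rw [hintegral] at hmass hmean
  simp only [one_mul] at h0 hmass
  have key := hf.integral_sq_mul_le_of_centered h0 h1 h2 hmass hmean
  rw [← hintegral, ← hintegral] at key
  have hsqrt : Real.sqrt (∫ x, x ^ 2 ∂μ) ≤ 2 * ∫ x, |x| ∂μ :=
    Real.sqrt_le_iff.2 ⟨by positivity, by linarith⟩
  linarith
end

section
/- If X is a real-valued random variable with a log-concave density, mean zero and variance 1 (i.e., isotropic), then P(|X| ≥ 1/4) ≥ 1/2, and consequently E(|X|) ≥ 1/8. -/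
open MeasureTheory
open scoped ENNReal

lemma IsLogConcaveFun.mul_le_mul_shift {f : ℝ → ℝ} (hf : IsLogConcaveFun f) {u v δ : ℝ}
    (hδ : 0 ≤ δ) (huv : u + δ ≤ v) : f u * f v ≤ f (u + δ) * f (v - δ) := by
  rcases hδ.eq_or_lt with rfl | hpos
  · simp
  have hd : 0 < v - u := by linarith
  set r := δ / (v - u) with hr
  have hr0 : 0 ≤ r := by positivity
  have hr1 : r ≤ 1 := by rw [hr, div_le_one hd]; linarith
  have hrd : r * (v - u) = δ := div_mul_cancel₀ _ hd.ne'
  have h₁ := hf.2 v u r hr0 hr1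
  have h₂ := hf.2 u v r hr0 hr1
  rw [show r * v + (1 - r) * u = u + δ by linarith] at h₁
  rw [show r * u + (1 - r) * v = v - δ by linarith] at h₂
  have hsplit (x : ℝ) : f x = f x ^ r * f x ^ (1 - r) := by
    rw [← Real.rpow_add' (hf.1 x) (by simp)]
    simp
  calc f u * f v = (f v ^ r * f u ^ (1 - r)) * (f u ^ r * f v ^ (1 - r)) := by
        nth_rw 1 [hsplit u, hsplit v]; ring
    _ ≤ f (u + δ) * f (v - δ) :=
        mul_le_mul h₁ h₂ (mul_nonneg (Real.rpow_nonneg (hf.1 _) _) (Real.rpow_nonneg (hf.1 _) _))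
          (hf.1 _)

lemma IsLogConcaveFun.measurable_s11 {f : ℝ → ℝ} (hf : IsLogConcaveFun f) : Measurable f := by
  refine measurable_of_Ioi fun c => ?_
  rcases lt_or_ge c 0 with hc | hc
  · convert MeasurableSet.univ
    ext x
    simpa using hc.trans_le (hf.1 x)
  refine Set.OrdConnected.measurableSet (Convex.ordConnected ?_)
  intro x hx y hy a b ha hb hab
  obtain rfl : b = 1 - a := by linarith
  refine lt_of_lt_of_le ?_ (hf.2 x y a ha (by linarith))
  simp only [Set.mem_preimage, Set.mem_Ioi] at hx hy
  have hm : c < min (f x) (f y) := lt_min hx hy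
  have hm0 : 0 ≤ min (f x) (f y) := hc.trans hm.le
  calc c < min (f x) (f y) := hm
    _ = min (f x) (f y) ^ a * min (f x) (f y) ^ (1 - a) := by
        rw [← Real.rpow_add' hm0 (by simp)]; simp
    _ ≤ f x ^ a * f y ^ (1 - a) :=
        mul_le_mul (Real.rpow_le_rpow hm0 (min_le_left _ _) ha)
          (Real.rpow_le_rpow hm0 (min_le_right _ _) hb) (Real.rpow_nonneg hm0 _)
          (Real.rpow_nonneg (hf.1 _) _)

lemma IsLogConcaveFun.comp_neg_s11 {f : ℝ → ℝ} (hf : IsLogConcaveFun f) :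
    IsLogConcaveFun fun x => f (-x) := by
  refine ⟨fun x => hf.1 _, fun x y t h0 h1 => (hf.2 (-x) (-y) t h0 h1).trans_eq ?_⟩
  congr 1
  ring

/-- Tails of a log-concave density are log-concave. -/
lemma IsLogConcaveFun.tail_mul_tail_le {f : ℝ → ℝ} (hf : IsLogConcaveFun f) {μ : Measure ℝ}
    (hμ : μ = volume.withDensity fun x => ENNReal.ofReal (f x)) [IsFiniteMeasure μ]
    {x y s : ℝ} (hyx : y ≤ x) (hs : 0 ≤ s) :
    μ.real (Set.Ici y) * μ.real (Set.Ici (x + s)) ≤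
      μ.real (Set.Ici x) * μ.real (Set.Ici (y + s)) := by
  have hfm := hf.measurable_s11
  have hF : Measurable fun x => ENNReal.ofReal (f x) := hfm.ennreal_ofReal
  obtain ⟨δ, rfl⟩ : ∃ δ, x = y + δ := ⟨x - y, by ring⟩
  have hδ : 0 ≤ δ := by linarith
  have key : μ (Set.Ico y (y + s)) * μ (Set.Ici (y + δ + s)) ≤
      μ (Set.Ico (y + δ) (y + δ + s)) * μ (Set.Ici (y + s)) := by
    rw [hμ, withDensity_apply _ measurableSet_Ico, withDensity_apply _ measurableSet_Ici,
      withDensity_apply _ measurableSet_Ico, withDensity_apply _ measurableSet_Ici]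
    have h₁ := (measurePreserving_add_right volume δ).setLIntegral_comp_preimage
      (measurableSet_Ico (a := y + δ) (b := y + δ + s)) hF
    have h₂ := (measurePreserving_sub_right volume δ).setLIntegral_comp_preimage
      (measurableSet_Ici (a := y + s)) hF
    have e₁ : (fun u => u + δ) ⁻¹' Set.Ico (y + δ) (y + δ + s) = Set.Ico y (y + s) := by
      ext u
      simp only [Set.mem_preimage, Set.mem_Ico]
      constructor <;> rintro ⟨_, _⟩ <;> constructor <;> linarith
    have e₂ : (fun u => u - δ) ⁻¹' Set.Ici (y + s) = Set.Ici (y + δ + s) := by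
      ext u
      simp only [Set.mem_preimage, Set.mem_Ici]
      constructor <;> intro _ <;> linarith
    rw [← h₁, ← h₂, e₁, e₂, ← lintegral_lintegral_mul hF.aemeasurable hF.aemeasurable,
      ← lintegral_lintegral_mul (by fun_prop) (by fun_prop)]
    refine setLIntegral_mono' measurableSet_Ico fun u hu => ?_
    refine setLIntegral_mono' measurableSet_Ici fun v hv => ?_
    rw [← ENNReal.ofReal_mul (hf.1 _), ← ENNReal.ofReal_mul (hf.1 _)]
    refine ENNReal.ofReal_le_ofReal (hf.mul_le_mul_shift hδ ?_)
    have := hu.2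
    have : y + δ + s ≤ v := hv
    linarith
  have key' := ENNReal.toReal_mono (by finiteness) key
  simp only [ENNReal.toReal_mul, ← measureReal_def] at key'
  have hsplit (z : ℝ) :
      μ.real (Set.Ici z) = μ.real (Set.Ico z (z + s)) + μ.real (Set.Ici (z + s)) := by
    rw [← measureReal_union _ measurableSet_Ici, Set.Ico_union_Ici_eq_Ici (by linarith)]
    exact (Set.Iio_disjoint_Ici le_rfl).mono_left fun u hu => hu.2
  rw [hsplit y, hsplit (y + δ)]
  linarith

lemma ofReal_sq_le_tsum {x : ℝ} (hx : 1 / 4 ≤ x) :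
    ENNReal.ofReal (x ^ 2) ≤ ∑' k : ℕ, ENNReal.ofReal ((k + 2) / 8) *
      (Set.Ici (1 / 4 + k * (1 / 4) : ℝ)).indicator 1 x := by
  set n := ⌊4 * (x - 1 / 4)⌋₊
  have hn : (n : ℝ) ≤ 4 * (x - 1 / 4) := Nat.floor_le (by linarith)
  have hn' : 4 * (x - 1 / 4) < n + 1 := Nat.lt_floor_add_one _
  have hsum (m : ℕ) : ∑ k ∈ Finset.range (m + 1), (((k : ℝ) + 2) / 8) = (m + 1) * (m + 4) / 16 := by
    induction m with
    | zero => norm_num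
    | succ m ih => rw [Finset.sum_range_succ, ih]; push_cast; ring
  refine le_trans ?_ (ENNReal.sum_le_tsum (Finset.range (n + 1)))
  calc ENNReal.ofReal (x ^ 2) ≤ ENNReal.ofReal (∑ k ∈ Finset.range (n + 1), (((k : ℝ) + 2) / 8)) := by
        refine ENNReal.ofReal_le_ofReal ?_
        rw [hsum]
        have : (0 : ℝ) ≤ n := n.cast_nonneg
        nlinarith
    _ = ∑ k ∈ Finset.range (n + 1), ENNReal.ofReal (((k : ℝ) + 2) / 8) :=
        ENNReal.ofReal_sum_of_nonneg fun k _ => by positivity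
    _ ≤ _ := by
        refine Finset.sum_le_sum fun k hk => ?_
        have hk' : (k : ℝ) ≤ n := by exact_mod_cast Nat.lt_succ_iff.mp (Finset.mem_range.mp hk)
        rw [Set.indicator_of_mem (by simp only [Set.mem_Ici]; linarith)]
        simp

lemma IsLogConcaveFun.setLIntegral_Ici_sq_le {f : ℝ → ℝ} (hf : IsLogConcaveFun f) {μ : Measure ℝ}
    (hμ : μ = volume.withDensity fun x => ENNReal.ofReal (f x)) [IsFiniteMeasure μ]
    (hI : μ.real (Set.Ici (1 / 4)) ≤ μ.real (Set.Ico (-(1 / 4)) (1 / 4))) :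
    ∫⁻ x in Set.Ici (1 / 4), ENNReal.ofReal (x ^ 2) ∂μ ≤
      ENNReal.ofReal (192 / 100 * μ.real (Set.Ici (1 / 4))) := by
  set T : ℝ → ℝ := fun x => μ.real (Set.Ici x) with hT
  have hT0 (x : ℝ) : 0 ≤ T x := measureReal_nonneg
  have hsplit : T (-(1 / 4)) = μ.real (Set.Ico (-(1 / 4)) (1 / 4)) + T (1 / 4) := by
    simp only [hT]
    rw [← measureReal_union _ measurableSet_Ici, Set.Ico_union_Ici_eq_Ici (by norm_num)]
    exact (Set.Iio_disjoint_Ici le_rfl).mono_left fun u hu => hu.2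
  have hlc {x y : ℝ} (h : y ≤ x) : T y * T (x + 1 / 4) ≤ T x * T (y + 1 / 4) :=
    hf.tail_mul_tail_le hμ h (by norm_num)
  have h0 : T (1 / 4) ≤ 71 / 100 * T 0 := by
    have h := hlc (y := -(1 / 4)) (x := 0) (by norm_num)
    norm_num only at h
    have : 2 * T (1 / 4) ≤ T (-(1 / 4)) := by linarith
    have h2 : 2 * T (1 / 4) * T (1 / 4) ≤ T 0 * T 0 :=
      (mul_le_mul_of_nonneg_right this (hT0 _)).trans (by norm_num only; exact h)
    nlinarith [hT0 0, hT0 (1 / 4)]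
  have hstep {x : ℝ} (hx : 0 ≤ x) : T (x + 1 / 4) ≤ 71 / 100 * T x := by
    rcases (hT0 0).eq_or_lt with h | h
    · have hle : T (x + 1 / 4) ≤ T 0 :=
        measureReal_mono (Set.Ici_subset_Ici.mpr (by linarith))
      linarith [hT0 x]
    · have h1 := hlc hx
      rw [zero_add] at h1
      have h2 := mul_le_mul_of_nonneg_left h0 (hT0 x)
      nlinarith
  have hgeom (k : ℕ) : T (1 / 4 + k * (1 / 4)) ≤ (71 / 100) ^ k * T (1 / 4) := by
    induction k with
    | zero => simp
    | succ k ih =>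
      have := hstep (x := 1 / 4 + k * (1 / 4)) (by positivity)
      rw [show (1 / 4 + ((k + 1 : ℕ) : ℝ) * (1 / 4)) = 1 / 4 + k * (1 / 4) + 1 / 4 by
        push_cast; ring, pow_succ]
      linarith
  have hs : HasSum (fun k : ℕ => (((k : ℝ) + 2) / 8) * ((71 / 100) ^ k * T (1 / 4)))
      ((71 / 100 / (1 - 71 / 100) ^ 2 + 2 * (1 - 71 / 100)⁻¹) * (T (1 / 4) / 8)) := by
    have h1 := hasSum_coe_mul_geometric_of_norm_lt_one (r := (71 / 100 : ℝ))
      (by rw [Real.norm_eq_abs, abs_of_pos] <;> norm_num)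
    have h2 := (hasSum_geometric_of_lt_one (r := (71 / 100 : ℝ)) (by norm_num)
      (by norm_num)).mul_left 2
    refine ((h1.add h2).mul_right (T (1 / 4) / 8)).congr_fun fun k => ?_
    ring
  calc ∫⁻ x in Set.Ici (1 / 4), ENNReal.ofReal (x ^ 2) ∂μ
      ≤ ∫⁻ x in Set.Ici (1 / 4), ∑' k : ℕ, ENNReal.ofReal ((k + 2) / 8) *
          (Set.Ici (1 / 4 + k * (1 / 4) : ℝ)).indicator 1 x ∂μ :=
        setLIntegral_mono' measurableSet_Ici fun x hx => ofReal_sq_le_tsum hx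
    _ ≤ ∫⁻ x, ∑' k : ℕ, ENNReal.ofReal ((k + 2) / 8) *
          (Set.Ici (1 / 4 + k * (1 / 4) : ℝ)).indicator 1 x ∂μ := setLIntegral_le_lintegral _ _
    _ = ∑' k : ℕ, ENNReal.ofReal ((k + 2) / 8) * μ (Set.Ici (1 / 4 + k * (1 / 4))) := by
        have hm (k : ℕ) :
            Measurable ((Set.Ici (1 / 4 + k * (1 / 4) : ℝ)).indicator (1 : ℝ → ℝ≥0∞)) :=
          measurable_one.indicator measurableSet_Ici
        rw [lintegral_tsum fun k => ((hm k).const_mul _).aemeasurable]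
        refine tsum_congr fun k => ?_
        rw [lintegral_const_mul _ (hm k), lintegral_indicator_one measurableSet_Ici]
    _ ≤ ∑' k : ℕ, ENNReal.ofReal (((k : ℝ) + 2) / 8 * ((71 / 100) ^ k * T (1 / 4))) := by
        refine ENNReal.tsum_le_tsum fun k => ?_
        rw [ENNReal.ofReal_mul (by positivity), ← ofReal_measureReal]
        gcongr
        exact hgeom k
    _ = ENNReal.ofReal ((71 / 100 / (1 - 71 / 100) ^ 2 + 2 * (1 - 71 / 100)⁻¹) *
          (T (1 / 4) / 8)) := by
        rw [← hs.tsum_eq, ENNReal.ofReal_tsum_of_nonneg (fun k => ?_) hs.summable]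
        have := hT0 (1 / 4)
        positivity
    _ ≤ ENNReal.ofReal (192 / 100 * T (1 / 4)) := by
        refine ENNReal.ofReal_le_ofReal ?_
        have := hT0 (1 / 4)
        norm_num
        linarith

lemma IsLogConcaveFun.setLIntegral_Iic_sq_le {f : ℝ → ℝ} (hf : IsLogConcaveFun f) {μ : Measure ℝ}
    (hμ : μ = volume.withDensity fun x => ENNReal.ofReal (f x)) [IsFiniteMeasure μ]
    (hI : μ.real (Set.Iic (-(1 / 4))) ≤ μ.real (Set.Ioc (-(1 / 4)) (1 / 4))) :
    ∫⁻ x in Set.Iic (-(1 / 4)), ENNReal.ofReal (x ^ 2) ∂μ ≤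
      ENNReal.ofReal (192 / 100 * μ.real (Set.Iic (-(1 / 4)))) := by
  have hF : Measurable fun x => ENNReal.ofReal (f x) := hf.measurable_s11.ennreal_ofReal
  have hmap : μ.map Neg.neg = volume.withDensity fun x => ENNReal.ofReal (f (-x)) := by
    ext s hs
    rw [Measure.map_apply measurable_neg hs, hμ, withDensity_apply _ (measurable_neg hs),
      withDensity_apply _ hs]
    have h := (Measure.measurePreserving_neg (volume : Measure ℝ)).setLIntegral_comp_preimage
      hs (f := fun x => ENNReal.ofReal (f (-x))) (hF.comp measurable_neg)
    simpa using h
  have hIci : μ.map Neg.neg (Set.Ici (1 / 4)) = μ (Set.Iic (-(1 / 4))) := by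
    rw [Measure.map_apply measurable_neg measurableSet_Ici]; simp
  have hIco : μ.map Neg.neg (Set.Ico (-(1 / 4)) (1 / 4)) = μ (Set.Ioc (-(1 / 4)) (1 / 4)) := by
    rw [Measure.map_apply measurable_neg measurableSet_Ico]; simp
  have h := hf.comp_neg_s11.setLIntegral_Ici_sq_le hmap
    (by simpa only [measureReal_def, hIci, hIco] using hI)
  rw [setLIntegral_map measurableSet_Ici (by fun_prop) measurable_neg] at h
  simpa only [measureReal_def, hIci, neg_sq, Set.neg_preimage, Set.neg_Ici] using h

/-- If `X` has a log-concave density, mean zero and variance one (isotropic), then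
`P(|X| ≥ 1/4) ≥ 1/2` and consequently `E|X| ≥ 1/8`. -/
theorem stmt11 (f : ℝ → ℝ) (μ : Measure ℝ)
    (hμ : μ = volume.withDensity fun x => ENNReal.ofReal (f x))
    (hf : IsLogConcaveFun f) (hprob : IsProbabilityMeasure μ)
    (hmean : ∫ x, x ∂μ = 0) (hvar : ∫ x, x ^ 2 ∂μ = 1) :
    (1 / 2 : ℝ≥0∞) ≤ μ {x : ℝ | 1 / 4 ≤ |x|} ∧ (1 / 8 : ℝ) ≤ ∫ x, |x| ∂μ := by
  have hint : Integrable (fun x : ℝ => x ^ 2) μ := by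
    by_contra h
    simp [integral_undef h] at hvar
  have hset : {x : ℝ | 1 / 4 ≤ |x|} = Set.Iic (-(1 / 4)) ∪ Set.Ici (1 / 4) := by
    ext x
    simp only [Set.mem_ofPred_eq, le_abs', Set.mem_union, Set.mem_Iic, Set.mem_Ici]
  have hms : MeasurableSet {x : ℝ | 1 / 4 ≤ |x|} := by
    rw [hset]; exact measurableSet_Iic.union measurableSet_Ici
  have hdisj : Disjoint (Set.Iic (-(1 / 4) : ℝ)) (Set.Ici (1 / 4)) :=
    Set.Iic_disjoint_Ici.mpr (by norm_num)
  have hmain : (1 / 2 : ℝ) ≤ μ.real {x : ℝ | 1 / 4 ≤ |x|} := by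
    by_contra! hlt
    have hadd : μ.real {x : ℝ | 1 / 4 ≤ |x|} =
        μ.real (Set.Iic (-(1 / 4))) + μ.real (Set.Ici (1 / 4)) := by
      rw [hset, measureReal_union hdisj measurableSet_Ici]
    have hcompl := probReal_compl_eq_one_sub (μ := μ) hms
    have hsub : {x : ℝ | 1 / 4 ≤ |x|}ᶜ = Set.Ioo (-(1 / 4)) (1 / 4) := by
      ext x
      simp [abs_lt]
    have hIco : μ.real {x : ℝ | 1 / 4 ≤ |x|}ᶜ ≤ μ.real (Set.Ico (-(1 / 4)) (1 / 4)) :=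
      measureReal_mono (hsub ▸ Set.Ioo_subset_Ico_self)
    have hIoc : μ.real {x : ℝ | 1 / 4 ≤ |x|}ᶜ ≤ μ.real (Set.Ioc (-(1 / 4)) (1 / 4)) :=
      measureReal_mono (hsub ▸ Set.Ioo_subset_Ioc_self)
    have hl0 : 0 ≤ μ.real (Set.Iic (-(1 / 4))) := measureReal_nonneg
    have hr0 : 0 ≤ μ.real (Set.Ici (1 / 4)) := measureReal_nonneg
    have hl := hf.setLIntegral_Iic_sq_le hμ (by linarith)
    have hr := hf.setLIntegral_Ici_sq_le hμ (by linarith)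
    have hc : ∫⁻ x in {x : ℝ | 1 / 4 ≤ |x|}ᶜ, ENNReal.ofReal (x ^ 2) ∂μ ≤
        ENNReal.ofReal (1 / 16 * μ.real {x : ℝ | 1 / 4 ≤ |x|}ᶜ) := by
      rw [ENNReal.ofReal_mul (by norm_num), ofReal_measureReal, ← setLIntegral_const]
      refine setLIntegral_mono' hms.compl fun x hx => ENNReal.ofReal_le_ofReal ?_
      rw [hsub] at hx
      nlinarith [hx.1, hx.2]
    have htot : ∫⁻ x, ENNReal.ofReal (x ^ 2) ∂μ = 1 := by
      rw [← ofReal_integral_eq_lintegral_ofReal hint (ae_of_all _ fun x => sq_nonneg x), hvar,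
        ENNReal.ofReal_one]
    rw [← lintegral_add_compl _ hms] at htot
    have hsplit := lintegral_union (μ := μ) (f := fun x => ENNReal.ofReal (x ^ 2))
      (measurableSet_Ici (a := (1 / 4 : ℝ))) hdisj
    rw [← hset] at hsplit
    rw [hsplit] at htot
    have hle := htot ▸ add_le_add (add_le_add hl hr) hc
    rw [← ENNReal.ofReal_add (by positivity) (by positivity),
      ← ENNReal.ofReal_add (by positivity) (by positivity), ENNReal.one_le_ofReal] at hle
    linarith
  refine ⟨?_, ?_⟩
  · rw [← ofReal_measureReal (μ := μ)]
    calc (1 / 2 : ℝ≥0∞) = ENNReal.ofReal (1 / 2) := by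
          rw [ENNReal.ofReal_div_of_pos two_pos]; simp
      _ ≤ _ := ENNReal.ofReal_le_ofReal hmain
  · have hintabs : Integrable (fun x : ℝ => |x|) μ := by
      refine (hint.add (integrable_const 1)).mono' (by fun_prop) (ae_of_all _ fun x => ?_)
      simp only [Real.norm_eq_abs, abs_abs, Pi.add_apply]
      nlinarith [sq_nonneg (|x| - 1), sq_abs x, abs_nonneg x]
    have h := mul_meas_ge_le_integral_of_nonneg (ae_of_all _ fun x : ℝ => abs_nonneg x) hintabs
      (1 / 4)
    linarith
end

section
/- Let A be a d×d random matrix with i.i.d. standard Gaussian entries (almost surely invertible). Then 1/‖A^{-1} 𝟙‖², where 𝟙 ∈ ℝ^d is the all-ones vector, has the same distribution as (1/d)·χ²_1; equivalently, 1/‖A^{-1}𝟙‖² is distributed as G²/d where G is a standard one-dimensional Gaussian. -/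
open MeasureTheory ProbabilityTheory

/-- The product of standard Gaussian measures on `ι → ℝ`. -/
noncomputable abbrev gaussianVec (ι : Type*) [Fintype ι] : Measure (ι → ℝ) :=
  Measure.pi fun _ : ι => gaussianReal 0 1

/-- The law of an `ι × κ` array of independent standard Gaussians. -/
noncomputable abbrev gaussianMat (ι κ : Type*) [Fintype ι] [Fintype κ] : Measure (ι → κ → ℝ) :=
  Measure.pi fun _ : ι => gaussianVec κ

/-- A unit linear functional of a standard Gaussian vector is standard Gaussian. -/
theorem map_dotProduct_gaussianVec {ι : Type*} [Fintype ι] (u : ι → ℝ)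
    (hu : ∑ i, u i ^ 2 = 1) :
    (gaussianVec ι).map (fun r => ∑ i, r i * u i) = gaussianReal 0 1 := by
  classical
  have hn : ‖(WithLp.toLp 2 u : EuclideanSpace ℝ ι)‖ ^ 2 = 1 := by
    rw [EuclideanSpace.real_norm_sq_eq]; exact hu
  have h := IsGaussian.map_eq_gaussianReal (μ := stdGaussian (EuclideanSpace ℝ ι))
    (innerSL ℝ (WithLp.toLp 2 u : EuclideanSpace ℝ ι))
  rw [integral_strongDual_stdGaussian, variance_dual_stdGaussian, innerSL_apply_norm, hn,
    ← map_pi_eq_stdGaussian, Measure.map_map (by fun_prop) (by fun_prop)] at h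
  convert! h using 1
  simp

theorem measurePreserving_swap_gaussianMat (ι κ : Type*) [Fintype ι] [Fintype κ] :
    MeasurePreserving (fun (A : ι → κ → ℝ) j i => A i j) (gaussianMat ι κ) (gaussianMat κ ι) := by
  have h1 := Measure.infinitePi_map_curry_symm (fun (_ : ι) (_ : κ) => gaussianReal 0 1)
  have h2 := Measure.infinitePi_map_curry (fun (_ : κ) (_ : ι) => gaussianReal 0 1)
  simp only [Measure.infinitePi_eq_pi] at h1 h2
  have m1 : MeasurePreserving (MeasurableEquiv.curry ι κ ℝ).symm (gaussianMat ι κ)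
      (gaussianVec (ι × κ)) := ⟨by fun_prop, h1⟩
  have m2 : MeasurePreserving (MeasurableEquiv.curry κ ι ℝ) (gaussianVec (κ × ι))
      (gaussianMat κ ι) := ⟨by fun_prop, h2⟩
  have m3 := measurePreserving_piCongrLeft (α := fun _ => ℝ)
    (fun _ : κ × ι => gaussianReal 0 1) (Equiv.prodComm ι κ)
  exact m2.comp (m3.comp m1)

/-- A standard Gaussian vector is invariant under change of orthonormal basis. -/
theorem measurePreserving_repr_gaussianVec {ι : Type*} [Fintype ι]
    (b : OrthonormalBasis ι ℝ (EuclideanSpace ℝ ι)) :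
    MeasurePreserving (fun (x : ι → ℝ) i => ∑ j, b i j * x j) (gaussianVec ι)
      (gaussianVec ι) := by
  classical
  refine ⟨by fun_prop, ?_⟩
  have h := stdGaussian_map b.repr
  rw [← map_pi_eq_stdGaussian, Measure.map_map (by fun_prop) (by fun_prop)] at h
  have h' := congrArg (Measure.map (WithLp.ofLp : EuclideanSpace ℝ ι → ι → ℝ)) h
  rw [Measure.map_map (by fun_prop) (by fun_prop), Measure.map_map (by fun_prop) (by fun_prop)] at h'
  convert! h' using 1
  · congr 1
    ext x i
    simp [OrthonormalBasis.repr_apply_apply, PiLp.inner_apply, mul_comm]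
  · exact Measure.map_id.symm

/-- Left multiplication by an orthogonal matrix preserves the Gaussian matrix law. -/
theorem measurePreserving_mul_gaussianMat {ι κ : Type*} [Fintype ι] [Fintype κ]
    (b : OrthonormalBasis ι ℝ (EuclideanSpace ℝ ι)) :
    MeasurePreserving (fun (A : ι → κ → ℝ) i k => ∑ j, b i j * A j k) (gaussianMat ι κ)
      (gaussianMat ι κ) := by
  have h : MeasurePreserving (fun (B : κ → ι → ℝ) k i => ∑ j, b i j * B k j) (gaussianMat κ ι)
      (gaussianMat κ ι) :=
    measurePreserving_pi _ _ fun _ => measurePreserving_repr_gaussianVec b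
  exact (measurePreserving_swap_gaussianMat κ ι).comp
    (h.comp (measurePreserving_swap_gaussianMat ι κ))

/-- The cofactors, along row zero, of a square matrix whose other rows are given. -/
noncomputable def rowCofactor {n : ℕ} (R : Fin n → Fin (n + 1) → ℝ) (j : Fin (n + 1)) : ℝ :=
  (-1) ^ (j : ℕ) * (Matrix.of fun i k => R i (j.succAbove k)).det

theorem det_eq_sum_rowCofactor {n : ℕ} (A : Fin (n + 1) → Fin (n + 1) → ℝ) :
    (Matrix.of A).det = ∑ j, A 0 j * rowCofactor (fun i => A i.succ) j := by
  rw [Matrix.det_succ_row_zero]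
  refine Finset.sum_congr rfl fun j _ => ?_
  rw [rowCofactor, Matrix.of_apply, mul_assoc, mul_left_comm]
  rfl

theorem adjugate_col_zero_eq_rowCofactor {n : ℕ} (A : Fin (n + 1) → Fin (n + 1) → ℝ)
    (j : Fin (n + 1)) :
    (Matrix.of A).adjugate j 0 = rowCofactor (fun i => A i.succ) j := by
  rw [Matrix.adjugate_fin_succ_eq_det_submatrix, rowCofactor]
  simp
  rfl

theorem measurable_rowCofactor {n : ℕ} : Measurable (rowCofactor (n := n)) := by
  refine measurable_pi_iff.2 fun j => Continuous.measurable ?_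
  unfold rowCofactor
  refine continuous_const.mul (Continuous.matrix_det ?_)
  exact continuous_matrix fun i k => by simp only [Matrix.of_apply]; fun_prop

/-- The component of row zero along the normalised cofactor vector. -/
noncomputable def normalComponent {n : ℕ} (A : Fin (n + 1) → Fin (n + 1) → ℝ) : ℝ :=
  ∑ j, A 0 j * (rowCofactor (fun i => A i.succ) j /
    √(∑ k, rowCofactor (fun i => A i.succ) k ^ 2))

theorem measurable_normalComponent {n : ℕ} : Measurable (normalComponent (n := n)) := by
  have h : Measurable fun A : Fin (n + 1) → Fin (n + 1) → ℝ => rowCofactor fun i => A i.succ :=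
    measurable_rowCofactor.comp (by fun_prop)
  have h' := fun j => measurable_pi_iff.1 h j
  unfold normalComponent
  fun_prop

theorem map_normalComponent {n : ℕ}
    (h0 : ∀ᵐ R ∂gaussianMat (Fin n) (Fin (n + 1)), rowCofactor R ≠ 0) :
    (gaussianMat (Fin (n + 1)) (Fin (n + 1))).map normalComponent = gaussianReal 0 1 := by
  have hs : MeasurePreserving
      (MeasurableEquiv.piFinSuccAbove (fun _ => Fin (n + 1) → ℝ) (0 : Fin (n + 1))).symm
      ((gaussianVec (Fin (n + 1))).prod (gaussianMat (Fin n) (Fin (n + 1))))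
      (gaussianMat (Fin (n + 1)) (Fin (n + 1))) :=
    (measurePreserving_piFinSuccAbove
      (fun _ : Fin (n + 1) => gaussianVec (Fin (n + 1))) 0).symm
  rw [← hs.map_eq, Measure.map_map measurable_normalComponent (MeasurableEquiv.measurable _)]
  ext s hm
  have hmeas := measurable_normalComponent.comp
    (MeasurableEquiv.piFinSuccAbove (fun _ => Fin (n + 1) → ℝ) (0 : Fin (n + 1))).symm.measurable
  rw [Measure.map_apply hmeas hm, Measure.prod_apply_symm (hmeas hm)]
  have key : ∀ᵐ R ∂gaussianMat (Fin n) (Fin (n + 1)),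
      gaussianVec (Fin (n + 1)) ((fun r => (r, R)) ⁻¹' (normalComponent ∘
        (MeasurableEquiv.piFinSuccAbove (fun _ => Fin (n + 1) → ℝ) (0 : Fin (n + 1))).symm ⁻¹' s))
        = gaussianReal 0 1 s := by
    filter_upwards [h0] with R hR
    have hpos : 0 < ∑ k, rowCofactor R k ^ 2 := by
      obtain ⟨j, hj⟩ := Function.ne_iff.1 hR
      exact Finset.sum_pos' (fun _ _ => sq_nonneg _) ⟨j, Finset.mem_univ _, by
        simp only [Pi.zero_apply] at hj; positivity⟩
    rw [← map_dotProduct_gaussianVec (fun j => rowCofactor R j / √(∑ k, rowCofactor R k ^ 2)),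
      Measure.map_apply (by fun_prop) hm]
    · rfl
    · simp_rw [div_pow, Real.sq_sqrt hpos.le, ← Finset.sum_div, div_self hpos.ne']
  refine (lintegral_congr_ae key).trans ?_
  simp

theorem det_eq_normalComponent_mul {n : ℕ} (A : Fin (n + 1) → Fin (n + 1) → ℝ) :
    (Matrix.of A).det =
      normalComponent A * √(∑ k, rowCofactor (fun i => A i.succ) k ^ 2) := by
  rw [det_eq_sum_rowCofactor, normalComponent, Finset.sum_mul]
  refine Finset.sum_congr rfl fun j _ => ?_
  by_cases h : √(∑ k, rowCofactor (fun i => A i.succ) k ^ 2) = 0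
  · have h1 : ∑ k, rowCofactor (fun i => A i.succ) k ^ 2 = 0 :=
      (Real.sqrt_eq_zero (Finset.sum_nonneg fun _ _ => sq_nonneg _)).1 h
    have h2 := (Finset.sum_eq_zero_iff_of_nonneg fun _ _ => sq_nonneg _).1 h1 j (Finset.mem_univ _)
    rw [pow_eq_zero_iff two_ne_zero] at h2
    simp [h2]
  · field_simp

theorem ae_rowCofactor_ne_zero_of_ae_det_ne_zero {n : ℕ}
    (h : ∀ᵐ A ∂gaussianMat (Fin n) (Fin n), (Matrix.of A).det ≠ 0) :
    ∀ᵐ R ∂gaussianMat (Fin n) (Fin (n + 1)), rowCofactor R ≠ 0 := by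
  have hp : MeasurePreserving (fun (R : Fin n → Fin (n + 1) → ℝ) i k => R i k.succ)
      (gaussianMat (Fin n) (Fin (n + 1))) (gaussianMat (Fin n) (Fin n)) := by
    refine measurePreserving_pi _ _ (f := fun _ (r : Fin (n + 1) → ℝ) (k : Fin n) => r k.succ) fun _ => ?_
    exact measurePreserving_snd.comp
      (measurePreserving_piFinSuccAbove (fun _ : Fin (n + 1) => gaussianReal 0 1) 0)
  filter_upwards [hp.quasiMeasurePreserving.ae h] with R hR hc
  apply hR
  simpa [rowCofactor] using congrFun hc 0

/-- A Gaussian matrix is almost surely invertible. -/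
theorem ae_det_ne_zero (n : ℕ) :
    ∀ᵐ A ∂gaussianMat (Fin n) (Fin n), (Matrix.of A).det ≠ 0 := by
  induction n with
  | zero => simp
  | succ n ih =>
    have h0 := ae_rowCofactor_ne_zero_of_ae_det_ne_zero ih
    have hN : ∀ᵐ g ∂gaussianReal 0 1, g ≠ 0 := by
      have := nullSingletonClass_gaussianReal (μ := 0) (v := 1) one_ne_zero
      simp [ae_iff]
    rw [← map_normalComponent h0] at hN
    have hN' := ae_of_ae_map measurable_normalComponent.aemeasurable hN
    have hp : MeasurePreserving (fun (A : Fin (n + 1) → Fin (n + 1) → ℝ) i => A i.succ)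
        (gaussianMat (Fin (n + 1)) (Fin (n + 1))) (gaussianMat (Fin n) (Fin (n + 1))) :=
      measurePreserving_snd.comp
        (measurePreserving_piFinSuccAbove (fun _ : Fin (n + 1) => gaussianVec (Fin (n + 1))) 0)
    filter_upwards [hN', hp.quasiMeasurePreserving.ae h0] with A hA hR
    rw [det_eq_normalComponent_mul]
    refine mul_ne_zero hA (Real.sqrt_ne_zero'.2 ?_)
    obtain ⟨j, hj⟩ := Function.ne_iff.1 hR
    exact Finset.sum_pos' (fun _ _ => sq_nonneg _) ⟨j, Finset.mem_univ _, by
      simp only [Pi.zero_apply] at hj; positivity⟩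

theorem inv_sum_sq_inv_mulVec_single {n : ℕ} (A : Fin (n + 1) → Fin (n + 1) → ℝ) (c : ℝ) :
    (∑ i, ((Matrix.of A)⁻¹.mulVec (Pi.single 0 c)) i ^ 2)⁻¹ = normalComponent A ^ 2 / c ^ 2 := by
  set S := ∑ k, rowCofactor (fun i => A i.succ) k ^ 2 with hS
  have hS0 : 0 ≤ S := Finset.sum_nonneg fun _ _ => sq_nonneg _
  have h1 : ∑ i, ((Matrix.of A)⁻¹.mulVec (Pi.single 0 c)) i ^ 2 =
      c ^ 2 * ((Matrix.of A).det⁻¹) ^ 2 * S := by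
    rw [hS, Finset.mul_sum]
    refine Finset.sum_congr rfl fun i _ => ?_
    rw [Matrix.mulVec_single, Matrix.inv_def]
    simp [adjugate_col_zero_eq_rowCofactor]
    ring
  rw [h1, det_eq_normalComponent_mul, ← hS]
  rcases hS0.eq_or_lt with h | h
  · have hn : normalComponent A = 0 := by
      rw [normalComponent, ← hS, ← h]; simp
    simp [hn]
  · rw [inv_pow, mul_pow, Real.sq_sqrt hS0]
    simp only [mul_inv, inv_inv]
    field_simp

theorem exists_orthonormalBasis_const (n : ℕ) :
    ∃ b : OrthonormalBasis (Fin (n + 1)) ℝ (EuclideanSpace ℝ (Fin (n + 1))),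
      ∀ i, ∑ j, b i j = (Pi.single 0 √(n + 1) : Fin (n + 1) → ℝ) i := by
  set s : ℝ := √(n + 1) with hs
  have hs0 : 0 < s := by positivity
  have hs2 : s ^ 2 = n + 1 := Real.sq_sqrt (by positivity)
  let v : EuclideanSpace ℝ (Fin (n + 1)) := WithLp.toLp 2 fun _ => s⁻¹
  have hv : ‖v‖ = 1 := by
    have : ‖v‖ ^ 2 = 1 := by
      rw [EuclideanSpace.real_norm_sq_eq]
      simp [v, hs2]
      field_simp
    exact (pow_eq_one_iff_of_nonneg (norm_nonneg _) two_ne_zero).1 this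
  obtain ⟨b, hb⟩ := Orthonormal.exists_orthonormalBasis_extension_of_card_eq (𝕜 := ℝ)
    (E := EuclideanSpace ℝ (Fin (n + 1))) (ι := Fin (n + 1)) (by simp)
    (v := fun _ => v) (s := {0}) (by
      refine ⟨fun _ => hv, fun i j hij => (hij (Subsingleton.elim _ _)).elim⟩)
  have hb0 : b 0 = v := hb 0 rfl
  refine ⟨b, fun i => ?_⟩
  have h := orthonormal_iff_ite.1 b.orthonormal i 0
  rw [hb0] at h
  have h2 : (∑ j, b i j) * s⁻¹ = if i = 0 then 1 else 0 := by
    rw [← h, Finset.sum_mul]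
    simp [PiLp.inner_apply, v, mul_comm]
  rw [Pi.single_apply]
  rw [mul_inv_eq_iff_eq_mul₀ hs0.ne'] at h2
  rw [h2]
  split_ifs <;> simp

/-- For a `d×d` random matrix `A` with i.i.d. standard Gaussian entries, the quantity
`1/‖A⁻¹𝟙‖²` (with `𝟙` the all-ones vector and `‖·‖` the Euclidean norm) is distributed
as `χ²₁/d`, i.e. as `G²/d` for a standard one-dimensional Gaussian `G`. -/
theorem stmt13 (d : ℕ) (hd : 0 < d) :
    Measure.map
        (fun A : Fin d → Fin d → ℝ =>
          (∑ i, ((Matrix.of A)⁻¹.mulVec (fun _ => (1 : ℝ))) i ^ 2)⁻¹)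
        (Measure.pi fun _ : Fin d => Measure.pi fun _ : Fin d => gaussianReal 0 1) =
      Measure.map (fun g : ℝ => g ^ 2 / d) (gaussianReal 0 1) := by
  obtain ⟨n, rfl⟩ := Nat.exists_eq_succ_of_ne_zero hd.ne'
  obtain ⟨b, hb⟩ := exists_orthonormalBasis_const n
  let Q : Matrix (Fin (n + 1)) (Fin (n + 1)) ℝ := Matrix.of fun i j => b i j
  have hQ : Q * Q.transpose = 1 := by
    ext i j
    rw [Matrix.one_apply, ← orthonormal_iff_ite.1 b.orthonormal i j]
    simp [Q, Matrix.mul_apply, PiLp.inner_apply, mul_comm]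
  have hQu : IsUnit Q.det := (Matrix.isUnit_iff_isUnit_det _).1 (IsUnit.of_mul_eq_one _ hQ)
  have hQ1 : Q.mulVec (fun _ => 1) = Pi.single 0 √(n + 1) := by
    ext i
    rw [← hb i]
    simp [Q, Matrix.mulVec, dotProduct]
  have hrot := measurePreserving_mul_gaussianMat (κ := Fin (n + 1)) b
  have hF : (fun A : Fin (n + 1) → Fin (n + 1) → ℝ =>
      (∑ i, ((Matrix.of A)⁻¹.mulVec (fun _ => (1 : ℝ))) i ^ 2)⁻¹) =
      (fun g : ℝ => g ^ 2 / ((n + 1 : ℕ) : ℝ)) ∘ normalComponent ∘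
        fun A i k => ∑ j, b i j * A j k := by
    ext A
    have hA : Matrix.of (fun i k => ∑ j, b i j * A j k) = Q * Matrix.of A := by
      ext i k
      simp [Q, Matrix.mul_apply]
    have h := inv_sum_sq_inv_mulVec_single (fun i k => ∑ j, b i j * A j k) √(n + 1)
    rw [hA, Matrix.mul_inv_rev, ← hQ1, Matrix.mulVec_mulVec, Matrix.mul_assoc,
      Matrix.nonsing_inv_mul _ hQu, Matrix.mul_one, Real.sq_sqrt (by positivity)] at h
    rw [h]
    simp
  rw [hF, ← Measure.map_map (by fun_prop) (measurable_normalComponent.comp hrot.measurable),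
    ← Measure.map_map measurable_normalComponent hrot.measurable, hrot.map_eq,
    map_normalComponent (ae_rowCofactor_ne_zero_of_ae_det_ne_zero (ae_det_ne_zero n))]
end

section
/- Let t ≥ 0 and let X be a standard one-dimensional Gaussian random variable conditioned on the event {X ≤ t}. Then the variance of X is at least 1 - 2/π. -/
open MeasureTheory ProbabilityTheory

lemma gaussianPDFReal_zero_one (x : ℝ) :
    gaussianPDFReal 0 1 x = (√(2 * Real.pi))⁻¹ * Real.exp (-(1 / 2) * x ^ 2) := by
  simp only [gaussianPDFReal, NNReal.coe_one, mul_one, sub_zero]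
  ring_nf

lemma hasDerivAt_gaussianPDFReal_zero_one (x : ℝ) :
    HasDerivAt (gaussianPDFReal 0 1) (-(x * gaussianPDFReal 0 1 x)) x := by
  have h := ((((hasDerivAt_id x).pow 2).const_mul (-(1 / 2) : ℝ)).exp).const_mul
    (√(2 * Real.pi))⁻¹
  rw [funext gaussianPDFReal_zero_one]
  refine h.congr_deriv ?_
  simp
  ring

lemma integrable_pow_mul_gaussianPDFReal_zero_one (n : ℕ) :
    Integrable (fun x ↦ x ^ n * gaussianPDFReal 0 1 x) := by
  have h := integrable_rpow_mul_exp_neg_mul_sq (b := 1 / 2) (by norm_num) (s := n)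
    (by linarith [Nat.cast_nonneg (α := ℝ) n])
  refine (h.const_mul (√(2 * Real.pi))⁻¹).congr (.of_forall fun x ↦ ?_)
  simp only [gaussianPDFReal_zero_one, Real.rpow_natCast]
  ring

lemma integral_Iic_mul_gaussianPDFReal_zero_one (t : ℝ) :
    ∫ x in Set.Iic t, x * gaussianPDFReal 0 1 x = -gaussianPDFReal 0 1 t := by
  have hint : Integrable (fun x ↦ -(x * gaussianPDFReal 0 1 x)) := by
    simpa using (integrable_pow_mul_gaussianPDFReal_zero_one 1).neg
  have hlim := tendsto_zero_of_hasDerivAt_of_integrableOn_Iic (a := t)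
    (fun x _ ↦ hasDerivAt_gaussianPDFReal_zero_one x) hint.integrableOn
    (integrable_gaussianPDFReal 0 1).integrableOn
  have h := integral_Iic_of_hasDerivAt_of_tendsto' (a := t)
    (fun x _ ↦ hasDerivAt_gaussianPDFReal_zero_one x) hint.integrableOn hlim
  rw [integral_neg] at h
  linarith

lemma integral_Iic_sq_mul_gaussianPDFReal_zero_one (t : ℝ) :
    ∫ x in Set.Iic t, x ^ 2 * gaussianPDFReal 0 1 x =
      (∫ x in Set.Iic t, gaussianPDFReal 0 1 x) - t * gaussianPDFReal 0 1 t := by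
  have hsq := integrable_pow_mul_gaussianPDFReal_zero_one 2
  have hpdf := integrable_gaussianPDFReal 0 1
  have hderiv (x : ℝ) : HasDerivAt (fun x ↦ x * gaussianPDFReal 0 1 x)
      (gaussianPDFReal 0 1 x - x ^ 2 * gaussianPDFReal 0 1 x) x := by
    refine ((hasDerivAt_id' x).mul (hasDerivAt_gaussianPDFReal_zero_one x)).congr_deriv ?_
    ring
  have hint := (hpdf.sub hsq).integrableOn (s := Set.Iic t)
  have hlim := tendsto_zero_of_hasDerivAt_of_integrableOn_Iic (a := t)
    (fun x _ ↦ hderiv x) hint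
    (by simpa using (integrable_pow_mul_gaussianPDFReal_zero_one 1).integrableOn)
  have h := integral_Iic_of_hasDerivAt_of_tendsto' (a := t) (fun x _ ↦ hderiv x) hint hlim
  rw [integral_sub hpdf.integrableOn hsq.integrableOn] at h
  linarith

lemma integral_Iic_zero_gaussianPDFReal_zero_one :
    ∫ x in Set.Iic 0, gaussianPDFReal 0 1 x = 1 / 2 := by
  have heven (x : ℝ) : gaussianPDFReal 0 1 (-x) = gaussianPDFReal 0 1 x := by
    simp [gaussianPDFReal_zero_one]
  have hsymm := integral_comp_neg_Iic (0 : ℝ) (gaussianPDFReal 0 1)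
  simp only [heven, neg_zero] at hsymm
  have hpdf := integrable_gaussianPDFReal 0 1
  have hsum := intervalIntegral.integral_Iic_add_Ioi (b := (0 : ℝ)) (μ := volume)
    hpdf.integrableOn hpdf.integrableOn
  rw [integral_gaussianPDFReal_eq_one 0 one_ne_zero] at hsum
  linarith

lemma half_add_mul_gaussianPDFReal_le_integral_Iic {t : ℝ} (ht : 0 ≤ t) :
    1 / 2 + t * gaussianPDFReal 0 1 t ≤ ∫ x in Set.Iic t, gaussianPDFReal 0 1 x := by
  have hpdf := integrable_gaussianPDFReal 0 1
  have hsplit := intervalIntegral.integral_Iic_sub_Iic (a := 0) (b := t) (μ := volume)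
    hpdf.integrableOn hpdf.integrableOn
  have hmono : ∫ _ in (0 : ℝ)..t, gaussianPDFReal 0 1 t ≤
      ∫ x in (0 : ℝ)..t, gaussianPDFReal 0 1 x := by
    refine intervalIntegral.integral_mono_on ht (by simp) hpdf.intervalIntegrable fun x hx ↦ ?_
    simp only [gaussianPDFReal_zero_one]
    have : x ^ 2 ≤ t ^ 2 := pow_le_pow_left₀ hx.1 hx.2 2
    gcongr ?_ * Real.exp ?_
    linarith
  rw [intervalIntegral.integral_const, smul_eq_mul] at hmono
  linarith [integral_Iic_zero_gaussianPDFReal_zero_one]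

lemma integral_cond_gaussianReal_Iic (t : ℝ) (f : ℝ → ℝ) :
    ∫ x, f x ∂((gaussianReal 0 1)[|Set.Iic t]) =
      (∫ x in Set.Iic t, f x * gaussianPDFReal 0 1 x) /
        ∫ x in Set.Iic t, gaussianPDFReal 0 1 x := by
  have hmass : (gaussianReal 0 1).real (Set.Iic t) =
      ∫ x in Set.Iic t, gaussianPDFReal 0 1 x := by
    rw [measureReal_def, gaussianReal_apply_eq_integral 0 one_ne_zero, ENNReal.toReal_ofReal]
    exact integral_nonneg fun x ↦ gaussianPDFReal_nonneg 0 1 x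
  have hnum : ∫ x in Set.Iic t, f x ∂gaussianReal 0 1 =
      ∫ x in Set.Iic t, f x * gaussianPDFReal 0 1 x := by
    rw [← integral_indicator measurableSet_Iic,
      integral_gaussianReal_eq_integral_smul one_ne_zero, ← integral_indicator measurableSet_Iic]
    congr with x
    by_cases hx : x ∈ Set.Iic t <;> simp [hx, mul_comm]
  rw [ProbabilityTheory.cond, integral_smul_measure, hnum, ENNReal.toReal_inv,
    ← measureReal_def, hmass, smul_eq_mul, div_eq_inv_mul]

lemma variance_cond_gaussianReal_Iic {t : ℝ}
    (hpos : 0 < ∫ x in Set.Iic t, gaussianPDFReal 0 1 x) :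
    variance id ((gaussianReal 0 1)[|Set.Iic t]) =
      1 - t * (gaussianPDFReal 0 1 t / ∫ x in Set.Iic t, gaussianPDFReal 0 1 x) -
        (gaussianPDFReal 0 1 t / ∫ x in Set.Iic t, gaussianPDFReal 0 1 x) ^ 2 := by
  have hne : gaussianReal 0 1 (Set.Iic t) ≠ 0 := by
    rw [gaussianReal_apply_eq_integral 0 one_ne_zero]
    simpa using hpos
  have := cond_isProbabilityMeasure hne
  have hmem : MemLp id 2 ((gaussianReal 0 1)[|Set.Iic t]) :=
    ((memLp_id_gaussianReal 2).restrict _).smul_measure (ENNReal.inv_ne_top.2 hne)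
  rw [variance_eq_sub hmem]
  simp only [Pi.pow_apply, id]
  rw [integral_cond_gaussianReal_Iic t (fun x ↦ x ^ 2),
    integral_cond_gaussianReal_Iic t (fun x ↦ x),
    integral_Iic_sq_mul_gaussianPDFReal_zero_one, integral_Iic_mul_gaussianPDFReal_zero_one]
  field_simp

lemma gaussianPDFReal_zero_one_sq_mul_le (t : ℝ) :
    gaussianPDFReal 0 1 t ^ 2 * (1 + t ^ 2) ≤ 1 / (2 * Real.pi) := by
  have hsq : gaussianPDFReal 0 1 t ^ 2 = 1 / (2 * Real.pi) * (Real.exp (t ^ 2))⁻¹ := by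
    rw [gaussianPDFReal_zero_one, mul_pow, inv_pow, Real.sq_sqrt (by positivity), ← Real.exp_nat_mul,
      ← Real.exp_neg, one_div]
    congr 2
    norm_num
    ring
  rw [hsq, mul_assoc]
  refine mul_le_of_le_one_right (by positivity) ?_
  rw [inv_mul_le_one₀ (Real.exp_pos _)]
  linarith [Real.add_one_le_exp (t ^ 2)]

/-- The variance of a standard Gaussian conditioned on being at most `t`, with `t ≥ 0`,
is at least `1 - 2/π`. -/
theorem stmt14 (t : ℝ) (ht : 0 ≤ t) :
    1 - 2 / Real.pi ≤ variance id ((gaussianReal 0 1)[|Set.Iic t]) := by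
  have hlow := half_add_mul_gaussianPDFReal_le_integral_Iic ht
  have hf : 0 ≤ gaussianPDFReal 0 1 t := gaussianPDFReal_nonneg 0 1 t
  have hsq := gaussianPDFReal_zero_one_sq_mul_le t
  have hpos : 0 < ∫ x in Set.Iic t, gaussianPDFReal 0 1 x := by
    linarith [mul_nonneg ht hf]
  rw [variance_cond_gaussianReal_Iic hpos]
  set f := gaussianPDFReal 0 1 t
  set r := f / ∫ x in Set.Iic t, gaussianPDFReal 0 1 x
  have htf : 0 ≤ t * f := mul_nonneg ht hf
  have hr : r ≤ f / (1 / 2 + t * f) := div_le_div_of_nonneg_left hf (by linarith) hlow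
  have hr₀ : 0 ≤ r := div_nonneg hf hpos.le
  have hbound : t * (f / (1 / 2 + t * f)) + (f / (1 / 2 + t * f)) ^ 2 ≤ 2 / Real.pi := by
    have hinv : 1 / 4 ≤ 1 / Real.pi := one_div_le_one_div_of_le Real.pi_pos Real.pi_le_four
    have hcomb : t * f * (1 / 2 + t * f) + f ^ 2 ≤ 2 / Real.pi * (1 / 2 + t * f) ^ 2 := by
      rw [div_eq_mul_one_div 2 Real.pi]
      have h2 : 1 / (2 * Real.pi) = 1 / 2 * (1 / Real.pi) := by ring
      rw [h2] at hsq
      nlinarith [mul_nonneg htf (sub_nonneg.2 hinv), mul_nonneg (sq_nonneg (t * f))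
        (sub_nonneg.2 hinv)]
    have hd : 0 < 1 / 2 + t * f := by linarith
    have heq : t * (f / (1 / 2 + t * f)) + (f / (1 / 2 + t * f)) ^ 2 =
        (t * f * (1 / 2 + t * f) + f ^ 2) / (1 / 2 + t * f) ^ 2 := by
      field_simp
    rw [heq, div_le_iff₀ (by positivity)]
    exact hcomb
  linarith [mul_le_mul_of_nonneg_left hr ht, pow_le_pow_left₀ hr₀ hr 2]
end

section
/- The supremum over ρ_1, ρ_2 ≥ 0 and w ∈ [-1,1] of e^{-(ρ_1²+ρ_2²)/2} · Φ((ρ_2 - ρ_1 w)/√(1-w²)) · Φ((ρ_1 - ρ_2 w)/√(1-w²)) · √(1-w²) is attained on the diagonal ρ_1 = ρ_2 and equals the supremum over ρ ≥ 0 and w ∈ [-1,1] of e^{-ρ²} · Φ(ρ(1-w)/√(1-w²))² · √(1-w²). -/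
/-- The standard Gaussian density `φ`. -/
noncomputable def gaussPdf (y : ℝ) : ℝ := (Real.sqrt (2 * Real.pi))⁻¹ * Real.exp (-y ^ 2 / 2)

/-- The standard Gaussian CDF `Φ`. -/
noncomputable def gaussCdf (y : ℝ) : ℝ := ∫ s in Set.Iic y, gaussPdf s

/-- The function `(ρ₁, ρ₂, w) ↦ e^{-(ρ₁²+ρ₂²)/2} Φ((ρ₂-ρ₁w)/√(1-w²)) Φ((ρ₁-ρ₂w)/√(1-w²)) √(1-w²)`. -/
noncomputable def F16 (ρ₁ ρ₂ w : ℝ) : ℝ :=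
  Real.exp (-(ρ₁ ^ 2 + ρ₂ ^ 2) / 2) *
    gaussCdf ((ρ₂ - ρ₁ * w) / Real.sqrt (1 - w ^ 2)) *
    gaussCdf ((ρ₁ - ρ₂ * w) / Real.sqrt (1 - w ^ 2)) * Real.sqrt (1 - w ^ 2)

open MeasureTheory Set Filter Topology

lemma gaussPdf_eq_gaussianPDFReal (y : ℝ) :
    gaussPdf y = ProbabilityTheory.gaussianPDFReal 0 1 y := by
  simp [gaussPdf, ProbabilityTheory.gaussianPDFReal]

lemma gaussPdf_pos (y : ℝ) : 0 < gaussPdf y := by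
  unfold gaussPdf
  positivity

lemma continuous_gaussPdf : Continuous gaussPdf := by
  unfold gaussPdf
  fun_prop

lemma integrable_gaussPdf : Integrable gaussPdf := by
  rw [funext gaussPdf_eq_gaussianPDFReal]
  exact ProbabilityTheory.integrable_gaussianPDFReal 0 1

lemma integral_gaussPdf : ∫ s, gaussPdf s = 1 := by
  simp_rw [gaussPdf_eq_gaussianPDFReal]
  exact ProbabilityTheory.integral_gaussianPDFReal_eq_one 0 one_ne_zero

lemma gaussCdf_pos (y : ℝ) : 0 < gaussCdf y := by
  unfold gaussCdf
  rw [setIntegral_pos_iff_support_of_nonneg_ae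
    (ae_of_all _ fun s => (gaussPdf_pos s).le) integrable_gaussPdf.integrableOn]
  have h : Function.support gaussPdf = univ :=
    Function.support_eq_univ fun s => (gaussPdf_pos s).ne'
  simp [h]

lemma gaussCdf_le_one (y : ℝ) : gaussCdf y ≤ 1 := by
  rw [← integral_gaussPdf]
  exact setIntegral_le_integral integrable_gaussPdf (ae_of_all _ fun s => (gaussPdf_pos s).le)

lemma hasDerivAt_gaussCdf (y : ℝ) : HasDerivAt gaussCdf (gaussPdf y) y := by
  have h : gaussCdf = fun x => (∫ s in (0 : ℝ)..x, gaussPdf s) + gaussCdf 0 := by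
    funext x
    rw [← intervalIntegral.integral_Iic_sub_Iic integrable_gaussPdf.integrableOn
      integrable_gaussPdf.integrableOn]
    simp [gaussCdf]
  rw [h]
  exact (intervalIntegral.integral_hasDerivAt_right integrable_gaussPdf.intervalIntegrable
    (continuous_gaussPdf.stronglyMeasurableAtFilter _ _) continuous_gaussPdf.continuousAt).add_const _

lemma continuous_gaussCdf : Continuous gaussCdf :=
  continuous_iff_continuousAt.2 fun y => (hasDerivAt_gaussCdf y).continuousAt

lemma hasDerivAt_gaussPdf (y : ℝ) : HasDerivAt gaussPdf (-y * gaussPdf y) y := by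
  unfold gaussPdf
  have h : HasDerivAt (fun x : ℝ => -x ^ 2 / 2) (-y) y := by
    refine ((hasDerivAt_pow 2 y).neg.div_const 2).congr_deriv ?_
    norm_num
    ring
  refine (h.exp.const_mul (Real.sqrt (2 * Real.pi))⁻¹).congr_deriv ?_
  ring

lemma integrable_neg_mul_gaussPdf : Integrable fun s => -s * gaussPdf s := by
  convert (integrable_mul_exp_neg_mul_sq (b := 1 / 2) (by norm_num)).const_mul
    (-(Real.sqrt (2 * Real.pi))⁻¹) using 2 with s
  rw [gaussPdf, show -s ^ 2 / 2 = -(1 / 2) * s ^ 2 by ring]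
  ring

lemma tendsto_gaussPdf_atBot : Tendsto gaussPdf atBot (𝓝 0) := by
  have h : Tendsto (fun x : ℝ => -x ^ 2 / 2) atBot atBot := by
    have h2 : Tendsto (fun x : ℝ => x ^ 2) atBot atTop := by
      simpa [Function.comp_def] using
        (tendsto_pow_atTop (α := ℝ) two_ne_zero).comp tendsto_abs_atBot_atTop
    exact (tendsto_neg_atTop_atBot.comp h2).atBot_div_const two_pos
  rw [← mul_zero (Real.sqrt (2 * Real.pi))⁻¹]
  exact (Real.tendsto_exp_atBot.comp h).const_mul (Real.sqrt (2 * Real.pi))⁻¹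

lemma neg_mul_gaussCdf_le_gaussPdf (y : ℝ) : -y * gaussCdf y ≤ gaussPdf y := by
  have h : ∫ s in Iic y, -s * gaussPdf s = gaussPdf y - 0 :=
    integral_Iic_of_hasDerivAt_of_tendsto' (fun s _ => hasDerivAt_gaussPdf s)
      integrable_neg_mul_gaussPdf.integrableOn tendsto_gaussPdf_atBot
  rw [sub_zero] at h
  rw [← h, gaussCdf, ← integral_const_mul]
  refine setIntegral_mono_on (integrable_gaussPdf.integrableOn.const_mul _)
    integrable_neg_mul_gaussPdf.integrableOn measurableSet_Iic fun s hs => ?_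
  exact mul_le_mul_of_nonneg_right (neg_le_neg hs) (gaussPdf_pos s).le

/-- The Gaussian CDF is log-concave. -/
lemma concaveOn_log_gaussCdf : ConcaveOn ℝ univ fun y => Real.log (gaussCdf y) := by
  have h1 (y : ℝ) : HasDerivAt (fun y => Real.log (gaussCdf y)) (gaussPdf y / gaussCdf y) y :=
    (hasDerivAt_gaussCdf y).log (gaussCdf_pos y).ne'
  refine concaveOn_of_hasDerivWithinAt2_nonpos convex_univ
    (fun y _ => (h1 y).continuousAt.continuousWithinAt)
    (fun y _ => (h1 y).hasDerivWithinAt)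
    (fun y _ => ((hasDerivAt_gaussPdf y).div (hasDerivAt_gaussCdf y)
      (gaussCdf_pos y).ne').hasDerivWithinAt) fun y _ => ?_
  refine div_nonpos_of_nonpos_of_nonneg ?_ (sq_nonneg _)
  nlinarith [mul_le_mul_of_nonneg_left (neg_mul_gaussCdf_le_gaussPdf y) (gaussPdf_pos y).le]

lemma gaussCdf_mul_gaussCdf_le (a b : ℝ) :
    gaussCdf a * gaussCdf b ≤ gaussCdf ((a + b) / 2) ^ 2 := by
  have h := concaveOn_log_gaussCdf.2 (mem_univ a) (mem_univ b)
    (by norm_num : (0 : ℝ) ≤ 1 / 2) (by norm_num : (0 : ℝ) ≤ 1 / 2) (by norm_num)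
  simp only [smul_eq_mul] at h
  rw [show 1 / 2 * a + 1 / 2 * b = (a + b) / 2 by ring] at h
  rw [← Real.log_le_log_iff (mul_pos (gaussCdf_pos a) (gaussCdf_pos b))
    (pow_pos (gaussCdf_pos _) 2), Real.log_mul (gaussCdf_pos a).ne' (gaussCdf_pos b).ne',
    Real.log_pow]
  push_cast
  linarith

lemma F16_self (ρ w : ℝ) : F16 ρ ρ w =
    Real.exp (-ρ ^ 2) * gaussCdf (ρ * (1 - w) / Real.sqrt (1 - w ^ 2)) ^ 2 *
      Real.sqrt (1 - w ^ 2) := by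
  rw [F16, show -(ρ ^ 2 + ρ ^ 2) / 2 = -ρ ^ 2 by ring, show ρ - ρ * w = ρ * (1 - w) by ring]
  ring

lemma F16_le_F16_midpoint (ρ₁ ρ₂ w : ℝ) :
    F16 ρ₁ ρ₂ w ≤ F16 ((ρ₁ + ρ₂) / 2) ((ρ₁ + ρ₂) / 2) w := by
  rw [F16_self, F16]
  refine mul_le_mul_of_nonneg_right ?_ (Real.sqrt_nonneg _)
  rw [mul_assoc]
  refine mul_le_mul (Real.exp_le_exp.2 (by nlinarith [sq_nonneg (ρ₁ - ρ₂)])) ?_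
    (mul_pos (gaussCdf_pos _) (gaussCdf_pos _)).le (Real.exp_pos _).le
  refine (gaussCdf_mul_gaussCdf_le _ _).trans_eq ?_
  congr 2
  ring

lemma F16_self_le (ρ w : ℝ) : F16 ρ ρ w ≤ Real.exp (-ρ ^ 2) * Real.sqrt (1 - w ^ 2) := by
  rw [F16_self]
  refine mul_le_mul_of_nonneg_right ?_ (Real.sqrt_nonneg _)
  exact mul_le_of_le_one_right (Real.exp_pos _).le
    (pow_le_one₀ (gaussCdf_pos _).le (gaussCdf_le_one _))

lemma exists_F16_self_max : ∃ ρ w : ℝ, 0 ≤ ρ ∧ w ∈ Icc (-1 : ℝ) 1 ∧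
    ∀ ρ' w' : ℝ, 0 ≤ ρ' → w' ∈ Icc (-1 : ℝ) 1 → F16 ρ' ρ' w' ≤ F16 ρ ρ w := by
  set ε := F16 0 0 0 with hε
  have hε0 : 0 < ε := by
    rw [hε, F16_self]
    simpa using pow_pos (gaussCdf_pos 0) 2
  have hε1 : ε ≤ 1 := by simpa using F16_self_le 0 0
  set K : Set (ℝ × ℝ) := Icc 0 (1 / ε) ×ˢ (Icc (-1) 1 ∩ {w | ε ≤ Real.sqrt (1 - w ^ 2)}) with hK
  have hKc : IsCompact K := isCompact_Icc.prod
    (isCompact_Icc.inter_right (isClosed_le continuous_const (by fun_prop)))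
  have hK0 : ((0 : ℝ), (0 : ℝ)) ∈ K := by
    simp [hK, hε0.le, hε1]
  have hcont : ContinuousOn (fun p : ℝ × ℝ => F16 p.1 p.1 p.2) K := by
    simp_rw [F16_self]
    refine ContinuousOn.mul (ContinuousOn.mul (by fun_prop)
      ((continuous_gaussCdf.comp_continuousOn ?_).pow 2)) (by fun_prop)
    exact ContinuousOn.div (by fun_prop) (by fun_prop) fun p hp =>
      (hε0.trans_le hp.2.2).ne'
  obtain ⟨⟨ρ, w⟩, hp, hmax⟩ := hKc.exists_isMaxOn ⟨_, hK0⟩ hcont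
  refine ⟨ρ, w, hp.1.1, hp.2.1, fun ρ' w' hρ' hw' => ?_⟩
  by_cases hmem : (ρ', w') ∈ K
  · exact hmax hmem
  refine le_trans ?_ (hmax hK0)
  by_contra! hlt
  have hlt' : ε < Real.exp (-ρ' ^ 2) * Real.sqrt (1 - w' ^ 2) := hlt.trans_le (F16_self_le ρ' w')
  have hexp : Real.exp (-ρ' ^ 2) ≤ 1 := Real.exp_le_one_iff.2 (by nlinarith)
  have hsqrt : Real.sqrt (1 - w' ^ 2) ≤ 1 := Real.sqrt_le_one.2 (by nlinarith)
  have hεexp : ε < Real.exp (-ρ' ^ 2) :=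
    hlt'.trans_le (mul_le_of_le_one_right (Real.exp_pos _).le hsqrt)
  have hεsqrt : ε < Real.sqrt (1 - w' ^ 2) :=
    hlt'.trans_le (mul_le_of_le_one_left (Real.sqrt_nonneg _) hexp)
  refine hmem ⟨⟨hρ', ?_⟩, hw', hεsqrt.le⟩
  rw [le_div_iff₀ hε0]
  have h1 : Real.exp (-ρ' ^ 2) * Real.exp (ρ' ^ 2) = 1 := by rw [← Real.exp_add]; simp
  have h2 := Real.add_one_le_exp (ρ' ^ 2)
  have h3 : ρ' ≤ Real.exp (ρ' ^ 2) := by nlinarith [sq_nonneg (ρ' - 1)]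
  calc ρ' * ε ≤ Real.exp (ρ' ^ 2) * Real.exp (-ρ' ^ 2) :=
        mul_le_mul h3 hεexp.le hε0.le (Real.exp_pos _).le
    _ = 1 := by rw [mul_comm, h1]

/-- The supremum of `F16` over `ρ₁, ρ₂ ≥ 0`, `w ∈ [-1,1]` is attained on the diagonal
`ρ₁ = ρ₂` and equals `sup_{ρ ≥ 0, w ∈ [-1,1]} e^{-ρ²} Φ(ρ(1-w)/√(1-w²))² √(1-w²)`. -/
theorem stmt16 :
    (∃ ρ w : ℝ, 0 ≤ ρ ∧ w ∈ Set.Icc (-1 : ℝ) 1 ∧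
      F16 ρ ρ w = sSup {z : ℝ | ∃ ρ₁ ρ₂ w' : ℝ, 0 ≤ ρ₁ ∧ 0 ≤ ρ₂ ∧
        w' ∈ Set.Icc (-1 : ℝ) 1 ∧ z = F16 ρ₁ ρ₂ w'}) ∧
    sSup {z : ℝ | ∃ ρ₁ ρ₂ w : ℝ, 0 ≤ ρ₁ ∧ 0 ≤ ρ₂ ∧ w ∈ Set.Icc (-1 : ℝ) 1 ∧
        z = F16 ρ₁ ρ₂ w} =
      sSup {z : ℝ | ∃ ρ w : ℝ, 0 ≤ ρ ∧ w ∈ Set.Icc (-1 : ℝ) 1 ∧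
        z = Real.exp (-ρ ^ 2) * gaussCdf (ρ * (1 - w) / Real.sqrt (1 - w ^ 2)) ^ 2 *
          Real.sqrt (1 - w ^ 2)} := by
  obtain ⟨ρ, w, hρ, hw, hmax⟩ := exists_F16_self_max
  have h1 : IsGreatest {z : ℝ | ∃ ρ₁ ρ₂ w' : ℝ, 0 ≤ ρ₁ ∧ 0 ≤ ρ₂ ∧
      w' ∈ Icc (-1 : ℝ) 1 ∧ z = F16 ρ₁ ρ₂ w'} (F16 ρ ρ w) := by
    refine ⟨⟨ρ, ρ, w, hρ, hρ, hw, rfl⟩, ?_⟩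
    rintro _ ⟨ρ₁, ρ₂, w', h₁, h₂, hw', rfl⟩
    exact (F16_le_F16_midpoint ρ₁ ρ₂ w').trans (hmax _ _ (by positivity) hw')
  have h2 : IsGreatest {z : ℝ | ∃ ρ w : ℝ, 0 ≤ ρ ∧ w ∈ Icc (-1 : ℝ) 1 ∧
      z = Real.exp (-ρ ^ 2) * gaussCdf (ρ * (1 - w) / Real.sqrt (1 - w ^ 2)) ^ 2 *
        Real.sqrt (1 - w ^ 2)} (F16 ρ ρ w) := by
    refine ⟨⟨ρ, w, hρ, hw, F16_self ρ w⟩, ?_⟩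
    rintro _ ⟨ρ', w', h', hw', rfl⟩
    rw [← F16_self]
    exact hmax _ _ h' hw'
  exact ⟨⟨ρ, w, hρ, hw, h1.csSup_eq.symm⟩, h1.csSup_eq.trans h2.csSup_eq.symm⟩
end
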